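/- For every Coxeter system (W, S) with S finite, the set L of all low elements of W includes S, is finite, is closed under join with respect to the right weak order (i.e. if u, v ∈ L and u ∨ v exists then u ∨ v ∈ L), and is closed under suffix (i.e. every suffix of an element of L lies in L). -/

import Mathlib

section RootSystemDefs

variable {S : Type*} {W : Type*} [Group W]

/-- The simple root `α_s` in the vector space `V = S → ℝ`. -/
def simpleRoot [DecidableEq S] (s : S) : S → ℝ := Pi.single s 1

/-- The symmetric bilinear form `B` on `V = S → ℝ` with `B(α_s, α_t) = -cos (π / m s t)`
(with the convention that `B(α_s, α_t) = -1` when `m s t = ∞`, which is encoded by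
`Mmat s t = 0`). -/
noncomputable def bform [Fintype S] (Mmat : CoxeterMatrix S) (v u : S → ℝ) : ℝ :=
  ∑ s : S, ∑ t : S,
    v s * u t * (if Mmat s t = 0 then -1 else -Real.cos (Real.pi / (Mmat s t : ℝ)))

/-- The conic closure of `X`: all nonnegative linear combinations of elements of `X`. -/
def coneOf {V : Type*} [AddCommMonoid V] [Module ℝ V] (X : Set V) : Set V :=
  {v | ∃ (n : ℕ) (c : Fin n → ℝ) (x : Fin n → V),
    (∀ i, 0 ≤ c i) ∧ (∀ i, x i ∈ X) ∧ v = ∑ i, c i • x i}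

variable [Fintype S] [DecidableEq S] {Mmat : CoxeterMatrix S}

/-- The root system `Φ = W(Δ)`, for the representation `ρ` of `W` on `V = S → ℝ`. -/
def rootSet (ρ : W →* ((S → ℝ) ≃ₗ[ℝ] (S → ℝ))) : Set (S → ℝ) :=
  {v | ∃ (w : W) (s : S), v = ρ w (simpleRoot s)}

/-- The positive roots `Φ⁺ = cone(Δ) ∩ Φ`. -/
def posRoots (ρ : W →* ((S → ℝ) ≃ₗ[ℝ] (S → ℝ))) : Set (S → ℝ) :=
  coneOf (Set.range (simpleRoot (S := S))) ∩ rootSet ρ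

/-- The negative roots `Φ⁻ = -Φ⁺`. -/
def negRoots (ρ : W →* ((S → ℝ) ≃ₗ[ℝ] (S → ℝ))) : Set (S → ℝ) :=
  {v | -v ∈ posRoots ρ}

/-- Dominance order: `Dominates ρ a b` means `a ≼ b`, i.e. every `w ∈ W` sending `b` to a
negative root also sends `a` to a negative root. -/
def Dominates (ρ : W →* ((S → ℝ) ≃ₗ[ℝ] (S → ℝ))) (a b : S → ℝ) : Prop :=
  ∀ w : W, ρ w b ∈ negRoots ρ → ρ w a ∈ negRoots ρ

/-- A small root: a positive root dominating no positive root other than itself. -/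
def IsSmallRoot (ρ : W →* ((S → ℝ) ≃ₗ[ℝ] (S → ℝ))) (b : S → ℝ) : Prop :=
  b ∈ posRoots ρ ∧ ∀ a ∈ posRoots ρ, Dominates ρ a b → a = b

/-- `t : W` is the reflection `s_b` in the root `b`: it acts on `V` by
`v ↦ v - 2 B(b, v) b`. -/
def IsReflIn (Mmat : CoxeterMatrix S) (ρ : W →* ((S → ℝ) ≃ₗ[ℝ] (S → ℝ)))
    (t : W) (b : S → ℝ) : Prop :=
  ∀ v : S → ℝ, ρ t v = v - (2 * bform Mmat b v) • b

/-- The (left) inversion set `N(w) = Φ⁺ ∩ w(Φ⁻)`. -/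
def invSet (ρ : W →* ((S → ℝ) ≃ₗ[ℝ] (S → ℝ))) (w : W) : Set (S → ℝ) :=
  {b | b ∈ posRoots ρ ∧ ρ w⁻¹ b ∈ negRoots ρ}

/-- `N¹(w) = {α ∈ Φ⁺ : ℓ(s_α w) = ℓ(w) - 1}`. -/
def nOne (cs : CoxeterSystem Mmat W) (ρ : W →* ((S → ℝ) ≃ₗ[ℝ] (S → ℝ)))
    (w : W) : Set (S → ℝ) :=
  {b | b ∈ posRoots ρ ∧
    ∃ t : W, IsReflIn Mmat ρ t b ∧ cs.length (t * w) + 1 = cs.length w}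

/-- A low element of `W`: an element `w` with `N¹(w) ⊆ Σ`. -/
def IsLow (cs : CoxeterSystem Mmat W) (ρ : W →* ((S → ℝ) ≃ₗ[ℝ] (S → ℝ)))
    (w : W) : Prop :=
  ∀ b ∈ nOne cs ρ w, IsSmallRoot ρ b

end RootSystemDefs

section CoxeterDefs

variable {S : Type*} {W : Type*} [Group W]

/-- The right weak order on `W`: `u ≤ w` iff `w = u * v` with `ℓ(w) = ℓ(u) + ℓ(v)`. -/
def WeakLE {Mmat : CoxeterMatrix S} (cs : CoxeterSystem Mmat W) (u w : W) : Prop :=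
  ∃ v : W, w = u * v ∧ cs.length w = cs.length u + cs.length v

/-- `u` is a suffix of `w`: `w = v * u` with `ℓ(w) = ℓ(v) + ℓ(u)`. -/
def IsSuffixOf {Mmat : CoxeterMatrix S} (cs : CoxeterSystem Mmat W) (u w : W) : Prop :=
  ∃ v : W, w = v * u ∧ cs.length w = cs.length v + cs.length u

/-- `j` is the join (least upper bound) of `u` and `v` in the right weak order. -/
def IsJoin {Mmat : CoxeterMatrix S} (cs : CoxeterSystem Mmat W) (u v j : W) : Prop :=
  WeakLE cs u j ∧ WeakLE cs v j ∧ ∀ k : W, WeakLE cs u k → WeakLE cs v k → WeakLE cs j k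

end CoxeterDefs

section LowElements

variable {S : Type*} {W : Type*} [Group W]

lemma rho_mul_apply (ρ : W →* ((S → ℝ) ≃ₗ[ℝ] (S → ℝ))) (u v : W) (x : S → ℝ) :
    ρ (u * v) x = ρ u (ρ v x) := by
  rw [map_mul, LinearEquiv.mul_apply]

lemma rho_one_apply (ρ : W →* ((S → ℝ) ≃ₗ[ℝ] (S → ℝ))) (x : S → ℝ) : ρ 1 x = x := by
  rw [map_one, LinearEquiv.coe_one, id]

lemma rho_inv_apply_apply (ρ : W →* ((S → ℝ) ≃ₗ[ℝ] (S → ℝ))) (w : W) (x : S → ℝ) :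
    ρ w⁻¹ (ρ w x) = x := by
  rw [← rho_mul_apply, inv_mul_cancel, rho_one_apply]

lemma rho_apply_inv_apply (ρ : W →* ((S → ℝ) ≃ₗ[ℝ] (S → ℝ))) (w : W) (x : S → ℝ) :
    ρ w (ρ w⁻¹ x) = x := by
  rw [← rho_mul_apply, mul_inv_cancel, rho_one_apply]

lemma simpleRoot_nonneg [DecidableEq S] (s t : S) : 0 ≤ simpleRoot s t := by
  unfold simpleRoot
  by_cases h : t = s
  · subst h
    simp
  · simp [h]

lemma simpleRoot_self [DecidableEq S] (s : S) : simpleRoot s s = 1 := by simp [simpleRoot]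

lemma simpleRoot_of_ne [DecidableEq S] {s t : S} (h : t ≠ s) : simpleRoot s t = 0 := by
  simp [simpleRoot, h]

variable [Fintype S] {M : CoxeterMatrix S}

/-! ### The bilinear form -/

lemma bform_add_left (u v w : S → ℝ) : bform M (u + v) w = bform M u w + bform M v w := by
  simp only [bform, Pi.add_apply, add_mul, Finset.sum_add_distrib]

lemma bform_smul_left (a : ℝ) (v w : S → ℝ) : bform M (a • v) w = a * bform M v w := by
  simp only [bform, Pi.smul_apply, smul_eq_mul, Finset.mul_sum, mul_assoc]

lemma bform_comm (v w : S → ℝ) : bform M v w = bform M w v := by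
  unfold bform
  rw [Finset.sum_comm]
  refine Finset.sum_congr rfl fun s _ => Finset.sum_congr rfl fun t _ => ?_
  rw [M.symmetric t s]
  ring

lemma bform_add_right (u v w : S → ℝ) : bform M u (v + w) = bform M u v + bform M u w := by
  rw [bform_comm, bform_add_left, bform_comm v, bform_comm w]

lemma bform_smul_right (a : ℝ) (v w : S → ℝ) : bform M v (a • w) = a * bform M v w := by
  rw [bform_comm, bform_smul_left, bform_comm]

lemma bform_neg_left (v w : S → ℝ) : bform M (-v) w = -bform M v w := by
  simpa using bform_smul_left (M := M) (-1) v w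

lemma bform_neg_right (v w : S → ℝ) : bform M v (-w) = -bform M v w := by
  simpa using bform_smul_right (M := M) (-1) v w

lemma bform_sub_left (u v w : S → ℝ) : bform M (u - v) w = bform M u w - bform M v w := by
  rw [sub_eq_add_neg, bform_add_left, bform_neg_left, sub_eq_add_neg]

lemma bform_sub_right (u v w : S → ℝ) : bform M u (v - w) = bform M u v - bform M u w := by
  rw [sub_eq_add_neg, bform_add_right, bform_neg_right, sub_eq_add_neg]

variable [DecidableEq S] {cs : CoxeterSystem M W} {ρ : W →* ((S → ℝ) ≃ₗ[ℝ] (S → ℝ))}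

lemma bform_simpleRoot_simpleRoot (s t : S) : bform M (simpleRoot s) (simpleRoot t) =
    if M s t = 0 then -1 else -Real.cos (Real.pi / (M s t : ℝ)) := by
  unfold bform simpleRoot
  rw [Finset.sum_eq_single s, Finset.sum_eq_single t]
  · simp
  · intro b _ hb
    simp [hb]
  · simp
  · intro b _ hb
    simp [hb]
  · simp

lemma bform_simpleRoot_self (s : S) : bform M (simpleRoot s) (simpleRoot s) = 1 := by
  simp [bform_simpleRoot_simpleRoot]

lemma eq_sum_smul_simpleRoot (v : S → ℝ) : v = ∑ s, v s • simpleRoot s := by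
  ext t
  simp [simpleRoot, Finset.sum_apply, Pi.single_apply]

/-- The hypotheses on `ρ`: it is the (faithful) standard geometric representation. -/
structure IsGeomRep (cs : CoxeterSystem M W) (ρ : W →* ((S → ℝ) ≃ₗ[ℝ] (S → ℝ))) : Prop where
  faithful : Function.Injective ρ
  simple_apply : ∀ (s : S) (v : S → ℝ),
    ρ (cs.simple s) v = v - (2 * bform M (simpleRoot s) v) • simpleRoot s

namespace IsGeomRep

lemma simple_apply_self (h : IsGeomRep cs ρ) (s : S) :
    ρ (cs.simple s) (simpleRoot s) = -simpleRoot s := by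
  rw [h.simple_apply, bform_simpleRoot_self]
  module

lemma simple_apply_simple_apply (_ : IsGeomRep cs ρ) (s : S) (v : S → ℝ) :
    ρ (cs.simple s) (ρ (cs.simple s) v) = v := by
  rw [← rho_mul_apply, cs.simple_mul_simple_self, rho_one_apply]

lemma bform_apply (h : IsGeomRep cs ρ) (w : W) (u v : S → ℝ) :
    bform M (ρ w u) (ρ w v) = bform M u v := by
  induction w using cs.simple_induction_left generalizing u v with
  | one => simp only [rho_one_apply]
  | mul_simple_left w s ih =>
    rw [rho_mul_apply, rho_mul_apply, h.simple_apply, h.simple_apply, ← ih u v]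
    simp only [bform_sub_left, bform_sub_right, bform_smul_left, bform_smul_right,
      bform_simpleRoot_self, bform_comm _ (simpleRoot s)]
    ring

lemma bform_apply_left (h : IsGeomRep cs ρ) (w : W) (u v : S → ℝ) :
    bform M (ρ w u) v = bform M u (ρ w⁻¹ v) := by
  rw [← h.bform_apply w u, rho_apply_inv_apply]

end IsGeomRep

/-! ### Sign-coherence of roots -/

/-- The sequence of coefficients of the roots of a rank two root subsystem. -/
def dihedralCoeff (c : ℝ) : ℕ → ℝ
  | 0 => 0
  | 1 => 1
  | n + 2 => 2 * c * dihedralCoeff c (n + 1) - dihedralCoeff c n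

lemma dihedralCoeff_add_two (c : ℝ) (n : ℕ) :
    dihedralCoeff c (n + 2) = 2 * c * dihedralCoeff c (n + 1) - dihedralCoeff c n := rfl

lemma dihedralCoeff_one (n : ℕ) : dihedralCoeff 1 n = n := by
  induction n using Nat.twoStepInduction with
  | zero => simp [dihedralCoeff]
  | one => simp [dihedralCoeff]
  | more n h1 h2 =>
    rw [dihedralCoeff_add_two, h1, h2]
    push_cast
    ring

lemma dihedralCoeff_cos_mul_sin (θ : ℝ) (n : ℕ) :
    dihedralCoeff (Real.cos θ) n * Real.sin θ = Real.sin (n * θ) := by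
  induction n using Nat.twoStepInduction with
  | zero => simp [dihedralCoeff]
  | one => simp [dihedralCoeff]
  | more n h1 h2 =>
    rw [dihedralCoeff_add_two, sub_mul, h1, mul_assoc, h2]
    have e1 : ((n + 2 : ℕ) : ℝ) * θ = ((n + 1 : ℕ) : ℝ) * θ + θ := by push_cast; ring
    have e2 : (n : ℝ) * θ = ((n + 1 : ℕ) : ℝ) * θ - θ := by push_cast; ring
    rw [e1, e2, Real.sin_add, Real.sin_sub]
    ring

lemma dihedralCoeff_nonneg {s r : S} (hsr : s ≠ r) {n : ℕ} (hn : M s r ≠ 0 → n ≤ M s r) :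
    0 ≤ dihedralCoeff (-bform M (simpleRoot s) (simpleRoot r)) n := by
  rw [bform_simpleRoot_simpleRoot]
  split_ifs with h0
  · rw [neg_neg, dihedralCoeff_one]
    positivity
  · rw [neg_neg]
    have h1 : M s r ≠ 1 := M.off_diagonal s r hsr
    have h2 : (2 : ℝ) ≤ M s r := by
      exact_mod_cast (by omega : 2 ≤ M s r)
    have hpi := Real.pi_pos
    have hsin : 0 < Real.sin (Real.pi / M s r) := by
      apply Real.sin_pos_of_pos_of_lt_pi (by positivity)
      rw [div_lt_iff₀ (by linarith)]
      nlinarith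
    refine nonneg_of_mul_nonneg_left (b := Real.sin (Real.pi / M s r)) ?_ hsin
    rw [dihedralCoeff_cos_mul_sin]
    apply Real.sin_nonneg_of_nonneg_of_le_pi (by positivity)
    have h3 : (n : ℝ) ≤ M s r := by exact_mod_cast hn h0
    rw [← mul_div_assoc, div_le_iff₀ (by linarith)]
    nlinarith

namespace IsGeomRep

lemma alternatingWord_apply (h : IsGeomRep cs ρ) (s r : S) (k : ℕ) :
    ρ (cs.wordProd (CoxeterSystem.alternatingWord s r k)) (simpleRoot s) =
      dihedralCoeff (-bform M (simpleRoot s) (simpleRoot r)) (k + 1) •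
        simpleRoot (if Even k then s else r) +
      dihedralCoeff (-bform M (simpleRoot s) (simpleRoot r)) k •
        simpleRoot (if Even k then r else s) := by
  induction k with
  | zero => simp [CoxeterSystem.alternatingWord, dihedralCoeff]
  | succ k ih =>
    rw [CoxeterSystem.alternatingWord_succ', cs.wordProd_cons, rho_mul_apply, ih,
      dihedralCoeff_add_two]
    by_cases hk : Even k
    · have hk' : ¬ Even (k + 1) := by simpa [Nat.even_add_one] using hk
      simp only [hk, hk', if_true, if_false, map_add, map_smul, h.simple_apply_self]
      rw [h.simple_apply, bform_comm (simpleRoot r)]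
      module
    · have hk' : Even (k + 1) := by simpa [Nat.even_add_one] using hk
      simp only [hk, hk', if_true, if_false, map_add, map_smul, h.simple_apply_self]
      rw [h.simple_apply]
      module

lemma apply_simpleRoot_nonneg (h : IsGeomRep cs ρ) (w : W) (s : S)
    (hw : cs.length w < cs.length (w * cs.simple s)) (t : S) :
    0 ≤ ρ w (simpleRoot s) t := by
  induction hn : cs.length w using Nat.strong_induction_on generalizing w s with
  | _ n ih =>
  subst hn
  by_cases hw1 : w = 1
  · subst hw1
    rw [rho_one_apply]
    exact simpleRoot_nonneg s t
  obtain ⟨r, hr⟩ := cs.exists_rightDescent_of_ne_one hw1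
  have hr' := (cs.isRightDescent_iff).1 hr
  have hsr : s ≠ r := by
    rintro rfl
    omega
  let P : ℕ → Prop := fun k => ∃ v, w = v * cs.wordProd (CoxeterSystem.alternatingWord s r k) ∧
    cs.length w = cs.length v + k
  have hP1 : P 1 := by
    refine ⟨w * cs.simple r, ?_, by omega⟩
    simp [CoxeterSystem.alternatingWord]
  classical
  have h1le : 1 ≤ cs.length w := by omega
  obtain ⟨v, hwv, hlv⟩ : P (Nat.findGreatest P (cs.length w)) := Nat.findGreatest_spec h1le hP1
  have hk1 : 1 ≤ Nat.findGreatest P (cs.length w) := Nat.le_findGreatest h1le hP1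
  have hmax : ∀ k, P k → k ≤ Nat.findGreatest P (cs.length w) := by
    rintro k ⟨v, hv⟩
    exact Nat.le_findGreatest (by omega) ⟨v, hv⟩
  generalize Nat.findGreatest P (cs.length w) = k at *
  have hlen : ∀ k, cs.length (cs.wordProd (CoxeterSystem.alternatingWord s r k)) ≤ k := fun k => by
    simpa using cs.length_wordProd_le (CoxeterSystem.alternatingWord s r k)
  have hx : cs.length v < cs.length (v * cs.simple (if Even k then r else s)) := by
    by_contra hcon
    have := cs.length_mul_simple v (if Even k then r else s)
    have := hmax (k + 1) ⟨v * cs.simple (if Even k then r else s), by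
      rw [CoxeterSystem.alternatingWord_succ', cs.wordProd_cons, mul_assoc,
        cs.simple_mul_simple_cancel_left, hwv], by omega⟩
    omega
  have hy : cs.length v < cs.length (v * cs.simple (if Even k then s else r)) := by
    by_contra hcon
    have h1 := cs.length_mul_simple v (if Even k then s else r)
    obtain ⟨j, rfl⟩ : ∃ j, k = j + 1 := ⟨k - 1, by omega⟩
    have h2 : (if Even (j + 1) then s else r) = if Even j then r else s := by
      simp only [Nat.even_add_one]
      split_ifs <;> simp_all
    rw [CoxeterSystem.alternatingWord_succ', cs.wordProd_cons, ← h2, ← mul_assoc] at hwv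
    have h3 := cs.length_mul_le (v * cs.simple (if Even (j + 1) then s else r))
      (cs.wordProd (CoxeterSystem.alternatingWord s r j))
    rw [← hwv] at h3
    have := hlen j
    omega
  have hkm : M s r ≠ 0 → k + 1 ≤ M s r := by
    intro h0
    by_contra hcon
    have h1 := cs.not_isReduced_alternatingWord r s (m := k + 1) (by rwa [M.symmetric])
      (by rw [M.symmetric]; omega)
    have h2 := cs.length_wordProd_le (CoxeterSystem.alternatingWord r s (k + 1))
    rw [CoxeterSystem.IsReduced] at h1
    have h3 : w * cs.simple s = v * cs.wordProd (CoxeterSystem.alternatingWord r s (k + 1)) := by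
      rw [CoxeterSystem.alternatingWord_succ, cs.wordProd_concat, ← mul_assoc, ← hwv]
    have h4 := cs.length_mul_le v (cs.wordProd (CoxeterSystem.alternatingWord r s (k + 1)))
    rw [← h3] at h4
    rw [CoxeterSystem.length_alternatingWord] at h1 h2
    omega
  rw [hwv, rho_mul_apply, h.alternatingWord_apply, map_add, map_smul, map_smul]
  have i1 := ih _ (by omega) v _ hx rfl
  have i2 := ih _ (by omega) v _ hy rfl
  have p1 := dihedralCoeff_nonneg (M := M) hsr hkm
  have p2 := dihedralCoeff_nonneg (M := M) (n := k) hsr (fun h0 => by have := hkm h0; omega)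
  simp only [Pi.add_apply, Pi.smul_apply, smul_eq_mul]
  positivity

end IsGeomRep

/-! ### Roots, signs and heights -/

/-- The height functional: the sum of the coordinates in the basis of simple roots. -/
def height {S : Type*} [Fintype S] : (S → ℝ) →ₗ[ℝ] ℝ := ∑ s, LinearMap.proj s

lemma height_apply {S : Type*} [Fintype S] (v : S → ℝ) : height v = ∑ s, v s := by
  simp [height]

lemma height_simpleRoot (s : S) : height (simpleRoot s) = 1 := by
  simp [height_apply, simpleRoot]

lemma mem_coneOf_range_simpleRoot_iff {v : S → ℝ} :
    v ∈ coneOf (Set.range (simpleRoot (S := S))) ↔ ∀ t, 0 ≤ v t := by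
  constructor
  · rintro ⟨n, c, x, hc, hx, rfl⟩ t
    rw [Finset.sum_apply]
    refine Finset.sum_nonneg fun i _ => ?_
    obtain ⟨s, hs⟩ := hx i
    rw [Pi.smul_apply, smul_eq_mul, ← hs]
    exact mul_nonneg (hc i) (simpleRoot_nonneg s t)
  · intro h
    refine ⟨Fintype.card S, fun i => v ((Fintype.equivFin S).symm i),
      fun i => simpleRoot ((Fintype.equivFin S).symm i), fun i => h _, fun i => ⟨_, rfl⟩, ?_⟩
    rw [Equiv.sum_comp (Fintype.equivFin S).symm (fun s => v s • simpleRoot s)]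
    exact eq_sum_smul_simpleRoot v

lemma simpleRoot_mem_rootSet (ρ : W →* ((S → ℝ) ≃ₗ[ℝ] (S → ℝ))) (s : S) :
    simpleRoot s ∈ rootSet ρ := ⟨1, s, (rho_one_apply ρ _).symm⟩

lemma apply_mem_rootSet {b : S → ℝ} (hb : b ∈ rootSet ρ) (w : W) : ρ w b ∈ rootSet ρ := by
  obtain ⟨u, s, rfl⟩ := hb
  exact ⟨w * u, s, (rho_mul_apply ρ w u _).symm⟩

lemma apply_mem_rootSet_iff {b : S → ℝ} {w : W} : ρ w b ∈ rootSet ρ ↔ b ∈ rootSet ρ :=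
  ⟨fun h => by simpa [rho_inv_apply_apply] using apply_mem_rootSet h w⁻¹,
    fun h => apply_mem_rootSet h w⟩

namespace IsGeomRep

lemma neg_mem_rootSet (h : IsGeomRep cs ρ) {b : S → ℝ} (hb : b ∈ rootSet ρ) :
    -b ∈ rootSet ρ := by
  obtain ⟨u, s, rfl⟩ := hb
  refine ⟨u * cs.simple s, s, ?_⟩
  rw [rho_mul_apply, h.simple_apply_self, map_neg]

lemma bform_self (h : IsGeomRep cs ρ) {b : S → ℝ} (hb : b ∈ rootSet ρ) : bform M b b = 1 := by
  obtain ⟨u, s, rfl⟩ := hb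
  rw [h.bform_apply, bform_simpleRoot_self]

lemma ne_zero (h : IsGeomRep cs ρ) {b : S → ℝ} (hb : b ∈ rootSet ρ) : b ≠ 0 := by
  rintro rfl
  have h1 := h.bform_self hb
  simp [bform] at h1

lemma nonneg_or_nonpos (h : IsGeomRep cs ρ) {b : S → ℝ} (hb : b ∈ rootSet ρ) :
    (∀ t, 0 ≤ b t) ∨ ∀ t, b t ≤ 0 := by
  obtain ⟨u, s, rfl⟩ := hb
  rcases cs.length_mul_simple u s with h1 | h1
  · exact Or.inl (h.apply_simpleRoot_nonneg u s (by omega))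
  · refine Or.inr fun t => ?_
    have := h.apply_simpleRoot_nonneg (u * cs.simple s) s (by
      rw [cs.simple_mul_simple_cancel_right]; omega) t
    rw [rho_mul_apply, h.simple_apply_self, map_neg] at this
    simpa using this

lemma mem_posRoots_iff (h : IsGeomRep cs ρ) {b : S → ℝ} :
    b ∈ posRoots ρ ↔ b ∈ rootSet ρ ∧ 0 < height b := by
  unfold posRoots
  rw [Set.mem_inter_iff, mem_coneOf_range_simpleRoot_iff, and_comm]
  refine and_congr_right fun hb => ?_
  rw [height_apply]
  constructor
  · intro h1
    refine lt_of_le_of_ne (Finset.sum_nonneg fun t _ => h1 t) fun h2 => h.ne_zero hb ?_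
    rw [eq_comm, Finset.sum_eq_zero_iff_of_nonneg fun t _ => h1 t] at h2
    ext t
    exact h2 t (Finset.mem_univ t)
  · intro h1
    rcases h.nonneg_or_nonpos hb with h2 | h2
    · exact h2
    · exact absurd (Finset.sum_nonpos fun t _ => h2 t) (not_le.2 h1)

lemma mem_negRoots_iff (h : IsGeomRep cs ρ) {b : S → ℝ} :
    b ∈ negRoots ρ ↔ b ∈ rootSet ρ ∧ height b < 0 := by
  change -b ∈ posRoots ρ ↔ _
  rw [h.mem_posRoots_iff, map_neg, neg_pos]
  exact and_congr_left fun _ => ⟨fun hb => by simpa using h.neg_mem_rootSet hb, h.neg_mem_rootSet⟩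

lemma height_ne_zero (h : IsGeomRep cs ρ) {b : S → ℝ} (hb : b ∈ rootSet ρ) : height b ≠ 0 := by
  rcases h.nonneg_or_nonpos hb with h1 | h1
  · exact (h.mem_posRoots_iff.1 ⟨mem_coneOf_range_simpleRoot_iff.2 h1, hb⟩).2.ne'
  · have h2 : -b ∈ posRoots ρ := ⟨mem_coneOf_range_simpleRoot_iff.2 fun t => by simpa using h1 t,
      h.neg_mem_rootSet hb⟩
    exact (h.mem_negRoots_iff.1 h2).2.ne

lemma nonneg_of_mem_posRoots (_ : IsGeomRep cs ρ) {b : S → ℝ} (hb : b ∈ posRoots ρ) (t : S) :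
    0 ≤ b t :=
  mem_coneOf_range_simpleRoot_iff.1 hb.1 t

lemma height_pos (h : IsGeomRep cs ρ) {b : S → ℝ} (hb : b ∈ posRoots ρ) : 0 < height b :=
  (h.mem_posRoots_iff.1 hb).2

lemma simpleRoot_mem_posRoots (h : IsGeomRep cs ρ) (s : S) : simpleRoot s ∈ posRoots ρ :=
  h.mem_posRoots_iff.2 ⟨simpleRoot_mem_rootSet ρ s, by rw [height_simpleRoot]; norm_num⟩

/-- A positive root other than `α_s` has a positive coordinate away from `s`. -/
lemma exists_ne_pos (h : IsGeomRep cs ρ) {b : S → ℝ} (hb : b ∈ posRoots ρ) {s : S}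
    (hbs : b ≠ simpleRoot s) : ∃ t, t ≠ s ∧ 0 < b t := by
  by_contra! hcon
  have h0 : ∀ t, t ≠ s → b t = 0 := fun t ht =>
    le_antisymm (hcon t ht) (h.nonneg_of_mem_posRoots hb t)
  have hb1 : b = b s • simpleRoot s := by
    ext t
    by_cases ht : t = s
    · subst ht
      simp [simpleRoot_self]
    · simp [simpleRoot_of_ne ht, h0 t ht]
  have h1 := h.bform_self hb.2
  rw [hb1, bform_smul_left, bform_smul_right, bform_simpleRoot_self] at h1
  have h2 := h.nonneg_of_mem_posRoots hb s
  have h3 : b s = 1 := by nlinarith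
  rw [h3, one_smul] at hb1
  exact hbs hb1

lemma simple_apply_apply_of_ne (h : IsGeomRep cs ρ) {s t : S} (hts : t ≠ s) (v : S → ℝ) :
    ρ (cs.simple s) v t = v t := by
  rw [h.simple_apply]
  simp [simpleRoot_of_ne hts]

lemma simple_apply_mem_posRoots (h : IsGeomRep cs ρ) {b : S → ℝ} (hb : b ∈ posRoots ρ) {s : S}
    (hbs : b ≠ simpleRoot s) : ρ (cs.simple s) b ∈ posRoots ρ := by
  obtain ⟨t, hts, ht⟩ := h.exists_ne_pos hb hbs
  have h1 := apply_mem_rootSet hb.2 (cs.simple s)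
  rcases h.nonneg_or_nonpos h1 with h2 | h2
  · exact ⟨mem_coneOf_range_simpleRoot_iff.2 h2, h1⟩
  · have := h2 t
    rw [h.simple_apply_apply_of_ne hts] at this
    linarith

lemma eq_simpleRoot_of_height_neg (h : IsGeomRep cs ρ) {b : S → ℝ} (hb : b ∈ posRoots ρ) {s : S}
    (hbs : height (ρ (cs.simple s) b) < 0) : b = simpleRoot s := by
  by_contra hne
  have := h.height_pos (h.simple_apply_mem_posRoots hb hne)
  linarith

/-- Sign dichotomy for roots in terms of height. -/
lemma height_neg_of_not_pos (h : IsGeomRep cs ρ) {b : S → ℝ} (hb : b ∈ rootSet ρ)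
    (hb' : ¬ 0 < height b) : height b < 0 :=
  lt_of_le_of_ne (not_lt.1 hb') (h.height_ne_zero hb)

lemma height_pos_of_not_neg (h : IsGeomRep cs ρ) {b : S → ℝ} (hb : b ∈ rootSet ρ)
    (hb' : ¬ height b < 0) : 0 < height b :=
  lt_of_le_of_ne (not_lt.1 hb') (h.height_ne_zero hb).symm

lemma dominates_iff (h : IsGeomRep cs ρ) {a b : S → ℝ} (ha : a ∈ rootSet ρ)
    (hb : b ∈ rootSet ρ) :
    Dominates ρ a b ↔ ∀ w, height (ρ w b) < 0 → height (ρ w a) < 0 := by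
  unfold Dominates
  simp only [h.mem_negRoots_iff, apply_mem_rootSet_iff, ha, hb, true_and]

lemma mem_invSet_iff (h : IsGeomRep cs ρ) {b : S → ℝ} {w : W} :
    b ∈ invSet ρ w ↔ b ∈ posRoots ρ ∧ height (ρ w⁻¹ b) < 0 := by
  change _ ∧ _ ↔ _
  refine and_congr_right fun hb => ?_
  rw [h.mem_negRoots_iff, apply_mem_rootSet_iff, and_iff_right hb.2]

end IsGeomRep

/-! ### Reflections -/

/-- The element of `W` acting as the reflection in the root `b`. -/
noncomputable def reflOf (M : CoxeterMatrix S) (ρ : W →* ((S → ℝ) ≃ₗ[ℝ] (S → ℝ)))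
    (b : S → ℝ) : W :=
  open Classical in if hb : ∃ t, IsReflIn M ρ t b then hb.choose else 1

namespace IsGeomRep

lemma isReflIn_reflOf (h : IsGeomRep cs ρ) {b : S → ℝ} (hb : b ∈ rootSet ρ) :
    IsReflIn M ρ (reflOf M ρ b) b := by
  have hex : ∃ t, IsReflIn M ρ t b := by
    obtain ⟨u, s, rfl⟩ := hb
    refine ⟨u * cs.simple s * u⁻¹, fun v => ?_⟩
    rw [rho_mul_apply, rho_mul_apply, h.simple_apply, map_sub, map_smul, rho_apply_inv_apply,
      h.bform_apply_left]
  unfold reflOf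
  rw [dif_pos hex]
  exact hex.choose_spec

lemma reflOf_apply (h : IsGeomRep cs ρ) {b : S → ℝ} (hb : b ∈ rootSet ρ) (v : S → ℝ) :
    ρ (reflOf M ρ b) v = v - (2 * bform M b v) • b :=
  h.isReflIn_reflOf hb v

lemma eq_of_apply_eq (h : IsGeomRep cs ρ) {u w : W} (huw : ∀ v, ρ u v = ρ w v) : u = w :=
  h.faithful (LinearEquiv.ext huw)

lemma eq_reflOf (h : IsGeomRep cs ρ) {b : S → ℝ} (hb : b ∈ rootSet ρ) {t : W}
    (ht : IsReflIn M ρ t b) : t = reflOf M ρ b :=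
  h.eq_of_apply_eq fun v => by rw [ht, h.reflOf_apply hb]

lemma reflOf_simpleRoot (h : IsGeomRep cs ρ) (s : S) :
    reflOf M ρ (simpleRoot s) = cs.simple s :=
  (h.eq_reflOf (simpleRoot_mem_rootSet ρ s) (h.simple_apply s)).symm

lemma reflOf_apply_self (h : IsGeomRep cs ρ) {b : S → ℝ} (hb : b ∈ rootSet ρ) :
    ρ (reflOf M ρ b) b = -b := by
  rw [h.reflOf_apply hb, h.bform_self hb]
  module

lemma reflOf_mul_self (h : IsGeomRep cs ρ) {b : S → ℝ} (hb : b ∈ rootSet ρ) :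
    reflOf M ρ b * reflOf M ρ b = 1 := by
  refine h.eq_of_apply_eq fun v => ?_
  rw [rho_mul_apply, rho_one_apply, h.reflOf_apply hb v, map_sub, map_smul, h.reflOf_apply hb,
    h.reflOf_apply_self hb]
  module

lemma inv_reflOf (h : IsGeomRep cs ρ) {b : S → ℝ} (hb : b ∈ rootSet ρ) :
    (reflOf M ρ b)⁻¹ = reflOf M ρ b :=
  inv_eq_of_mul_eq_one_left (h.reflOf_mul_self hb)

lemma reflOf_mul_cancel_left (h : IsGeomRep cs ρ) {b : S → ℝ} (hb : b ∈ rootSet ρ) (w : W) :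
    reflOf M ρ b * (reflOf M ρ b * w) = w := by
  rw [← mul_assoc, h.reflOf_mul_self hb, one_mul]

lemma reflOf_apply_reflOf_apply (h : IsGeomRep cs ρ) {b : S → ℝ} (hb : b ∈ rootSet ρ)
    (v : S → ℝ) : ρ (reflOf M ρ b) (ρ (reflOf M ρ b) v) = v := by
  rw [← rho_mul_apply, h.reflOf_mul_self hb, rho_one_apply]

lemma reflOf_neg (h : IsGeomRep cs ρ) {b : S → ℝ} (hb : b ∈ rootSet ρ) :
    reflOf M ρ (-b) = reflOf M ρ b := by
  refine h.eq_reflOf hb fun v => ?_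
  rw [h.reflOf_apply (h.neg_mem_rootSet hb), bform_neg_left]
  module

lemma reflOf_conj (h : IsGeomRep cs ρ) {b : S → ℝ} (hb : b ∈ rootSet ρ) (w : W) :
    reflOf M ρ (ρ w b) = w * reflOf M ρ b * w⁻¹ := by
  refine (h.eq_reflOf (apply_mem_rootSet hb w) fun v => ?_).symm
  rw [rho_mul_apply, rho_mul_apply, h.reflOf_apply hb, map_sub, map_smul, rho_apply_inv_apply,
    h.bform_apply_left]

lemma sub_smul_mem_rootSet (h : IsGeomRep cs ρ) {b c : S → ℝ} (hb : b ∈ rootSet ρ)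
    (hc : c ∈ rootSet ρ) : c - (2 * bform M b c) • b ∈ rootSet ρ := by
  rw [← h.reflOf_apply hb]
  exact apply_mem_rootSet hc _

lemma smul_sub_mem_rootSet (h : IsGeomRep cs ρ) {b c : S → ℝ} (hb : b ∈ rootSet ρ)
    (hc : c ∈ rootSet ρ) : (2 * bform M b c) • b - c ∈ rootSet ρ := by
  rw [← neg_sub]
  exact h.neg_mem_rootSet (h.sub_smul_mem_rootSet hb hc)

/-- Roots proportional to a root are its multiples by `±1`. -/
lemma eq_or_eq_neg_of_eq_smul (h : IsGeomRep cs ρ) {b c : S → ℝ} (hb : b ∈ rootSet ρ)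
    (hc : c ∈ rootSet ρ) {x : ℝ} (hx : c = x • b) : c = b ∨ c = -b := by
  have h1 := h.bform_self hc
  rw [hx, bform_smul_left, bform_smul_right, h.bform_self hb] at h1
  have h2 : (x - 1) * (x + 1) = 0 := by linarith
  rcases mul_eq_zero.1 h2 with h3 | h3
  · left
    rw [hx, show x = 1 by linarith, one_smul]
  · right
    rw [hx, show x = -1 by linarith, neg_one_smul]

end IsGeomRep

/-! ### Inversion sets and length -/

namespace IsGeomRep

lemma mem_invSet_simple_iff (h : IsGeomRep cs ρ) (s : S) (w : W) :
    simpleRoot s ∈ invSet ρ w ↔ cs.length (cs.simple s * w) < cs.length w := by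
  have key : ∀ w : W, cs.length w < cs.length (cs.simple s * w) →
      0 < height (ρ w⁻¹ (simpleRoot s)) := by
    intro w hw
    have h1 := h.apply_simpleRoot_nonneg w⁻¹ s (by
      rw [← cs.length_inv (w⁻¹ * _)]; simpa using hw)
    refine h.height_pos (b := ρ w⁻¹ (simpleRoot s)) ⟨?_, ?_⟩
    · exact mem_coneOf_range_simpleRoot_iff.2 h1
    · exact apply_mem_rootSet (simpleRoot_mem_rootSet ρ s) _
  rw [h.mem_invSet_iff, and_iff_right (h.simpleRoot_mem_posRoots s)]
  constructor
  · intro h1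
    by_contra h2
    have := key w (lt_of_le_of_ne (not_lt.1 h2) (cs.length_simple_mul_ne w s).symm)
    linarith
  · intro h1
    have h2 := key (cs.simple s * w) (by rwa [cs.simple_mul_simple_cancel_left])
    rw [mul_inv_rev, cs.inv_simple, rho_mul_apply, h.simple_apply_self, map_neg, map_neg] at h2
    linarith

lemma simple_apply_mem_invSet_iff (h : IsGeomRep cs ρ) {b : S → ℝ} (hb : b ∈ posRoots ρ) {s : S}
    (hbs : b ≠ simpleRoot s) (w : W) :
    ρ (cs.simple s) b ∈ invSet ρ (cs.simple s * w) ↔ b ∈ invSet ρ w := by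
  rw [h.mem_invSet_iff, h.mem_invSet_iff, and_iff_right hb,
    and_iff_right (h.simple_apply_mem_posRoots hb hbs), mul_inv_rev, cs.inv_simple, rho_mul_apply,
    h.simple_apply_simple_apply]

lemma simple_apply_ne (h : IsGeomRep cs ρ) {b : S → ℝ} (hb : b ∈ posRoots ρ) (s : S) :
    ρ (cs.simple s) b ≠ simpleRoot s := by
  intro h1
  have h2 : b = -simpleRoot s := by
    rw [← h.simple_apply_self, ← h1, h.simple_apply_simple_apply]
  have h3 := h.height_pos hb
  have h4 := h.height_pos (h.simpleRoot_mem_posRoots s)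
  rw [h2, map_neg] at h3
  linarith

lemma invSet_simple_mul (h : IsGeomRep cs ρ) {s : S} {w : W}
    (hw : cs.length w < cs.length (cs.simple s * w)) :
    invSet ρ (cs.simple s * w) = insert (simpleRoot s) (ρ (cs.simple s) '' invSet ρ w) := by
  ext b
  rw [Set.mem_insert_iff, Set.mem_image]
  have hs : simpleRoot s ∉ invSet ρ w := by
    rw [h.mem_invSet_simple_iff]
    omega
  constructor
  · intro hb
    by_cases hbs : b = simpleRoot s
    · exact Or.inl hbs
    · refine Or.inr ⟨ρ (cs.simple s) b, ?_, h.simple_apply_simple_apply s b⟩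
      rwa [← h.simple_apply_mem_invSet_iff (h.simple_apply_mem_posRoots hb.1 hbs)
        (h.simple_apply_ne hb.1 s), h.simple_apply_simple_apply]
  · rintro (rfl | ⟨c, hc, rfl⟩)
    · rw [h.mem_invSet_simple_iff, cs.simple_mul_simple_cancel_left]
      exact hw
    · rw [h.simple_apply_mem_invSet_iff hc.1 fun hcs => hs (hcs ▸ hc)]
      exact hc

lemma invSet_one (h : IsGeomRep cs ρ) : invSet ρ (1 : W) = ∅ := by
  ext b
  simp only [h.mem_invSet_iff, inv_one, rho_one_apply, Set.mem_empty_iff_false, iff_false]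
  rintro ⟨h1, h2⟩
  have := h.height_pos h1
  linarith

lemma exists_simpleRoot_mem_invSet (h : IsGeomRep cs ρ) {w : W} (hw : w ≠ 1) :
    ∃ s, simpleRoot s ∈ invSet ρ w := by
  obtain ⟨s, hs⟩ := cs.exists_leftDescent_of_ne_one hw
  exact ⟨s, (h.mem_invSet_simple_iff s w).2 hs⟩

lemma length_simple_mul_of_mem (h : IsGeomRep cs ρ) {s : S} {w : W}
    (hs : simpleRoot s ∈ invSet ρ w) : cs.length (cs.simple s * w) + 1 = cs.length w := by
  have h1 := (h.mem_invSet_simple_iff s w).1 hs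
  have h2 := cs.length_simple_mul w s
  omega

lemma finite_invSet_and_ncard (h : IsGeomRep cs ρ) (w : W) :
    (invSet ρ w).Finite ∧ (invSet ρ w).ncard = cs.length w := by
  induction hn : cs.length w generalizing w with
  | zero =>
    rw [cs.length_eq_zero_iff] at hn
    subst hn
    simp [h.invSet_one]
  | succ n ih =>
    have hw1 : w ≠ 1 := by
      rintro rfl
      simp at hn
    obtain ⟨s, hs⟩ := h.exists_simpleRoot_mem_invSet hw1
    have hl := h.length_simple_mul_of_mem hs
    obtain ⟨h1, h2⟩ := ih (cs.simple s * w) (by omega)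
    have h3 := h.invSet_simple_mul (s := s) (w := cs.simple s * w)
      (by rw [cs.simple_mul_simple_cancel_left]; omega)
    rw [cs.simple_mul_simple_cancel_left] at h3
    have hinj : Function.Injective (ρ (cs.simple s)) := (ρ (cs.simple s)).injective
    rw [h3]
    refine ⟨(h1.image _).insert _, ?_⟩
    rw [Set.ncard_insert_of_notMem _ (h1.image _), Set.ncard_image_of_injective _ hinj, h2]
    rintro ⟨c, hc, hcs⟩
    exact h.simple_apply_ne hc.1 s hcs

lemma finite_invSet (h : IsGeomRep cs ρ) (w : W) : (invSet ρ w).Finite :=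
  (h.finite_invSet_and_ncard w).1

lemma ncard_invSet (h : IsGeomRep cs ρ) (w : W) : (invSet ρ w).ncard = cs.length w :=
  (h.finite_invSet_and_ncard w).2

/-- Reflecting in an inversion `b` of `u` decreases the length by the number of inversions `η`
of `u` whose negated mirror image is also an inversion. -/
lemma length_eq_length_reflOf_mul_add (h : IsGeomRep cs ρ) {u : W} {b : S → ℝ}
    (hb : b ∈ invSet ρ u) :
    cs.length u = cs.length (reflOf M ρ b * u) +
      {η ∈ invSet ρ u | (2 * bform M b η) • b - η ∈ invSet ρ u}.ncard := by
  classical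
  have hbr := hb.1.2
  have hbpos := h.height_pos hb.1
  have hbneg := (h.mem_invSet_iff.1 hb).2
  set t := reflOf M ρ b with ht
  set E := {η ∈ invSet ρ u | (2 * bform M b η) • b - η ∈ invSet ρ u} with hE
  have hmemt : ∀ c, c ∈ invSet ρ (t * u) ↔ c ∈ posRoots ρ ∧ height (ρ u⁻¹ (ρ t c)) < 0 := by
    intro c
    rw [h.mem_invSet_iff, mul_inv_rev, h.inv_reflOf hbr, rho_mul_apply]
  have hneg : ∀ η, (2 * bform M b η) • b - η = -ρ t η := fun η => by
    rw [h.reflOf_apply hbr, neg_sub]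
  let f : (S → ℝ) → (S → ℝ) := fun c => if 0 < height (ρ t c) then ρ t c else c
  have himg : f '' invSet ρ (t * u) = invSet ρ u \ E := by
    ext η
    constructor
    · rintro ⟨c, hc, rfl⟩
      obtain ⟨hc1, hc2⟩ := (hmemt c).1 hc
      have hcpos := h.height_pos hc1
      have hctr : ρ t c ∈ rootSet ρ := apply_mem_rootSet hc1.2 t
      by_cases hp : 0 < height (ρ t c)
      · simp only [f, if_pos hp]
        refine ⟨h.mem_invSet_iff.2 ⟨h.mem_posRoots_iff.2 ⟨hctr, hp⟩, hc2⟩, fun hcE => ?_⟩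
        have h1 := h.height_pos hcE.2.1
        rw [hneg, h.reflOf_apply_reflOf_apply hbr, map_neg] at h1
        linarith
      · simp only [f, if_neg hp]
        have hp' := h.height_neg_of_not_pos hctr hp
        have e1 : height (ρ t c) = height c - 2 * bform M b c * height b := by
          rw [h.reflOf_apply hbr, map_sub, map_smul, smul_eq_mul]
        have e2 : height (ρ u⁻¹ (ρ t c)) =
            height (ρ u⁻¹ c) - 2 * bform M b c * height (ρ u⁻¹ b) := by
          rw [h.reflOf_apply hbr, map_sub, map_sub, map_smul, map_smul, smul_eq_mul]
        have hB : 0 < bform M b c := by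
          by_contra hB
          nlinarith [mul_nonneg (neg_nonneg.2 (not_lt.1 hB)) hbpos.le]
        refine ⟨h.mem_invSet_iff.2 ⟨hc1, ?_⟩, fun hcE => ?_⟩
        · nlinarith [mul_pos hB (neg_pos.2 hbneg)]
        · have h1 := (h.mem_invSet_iff.1 hcE.2).2
          rw [hneg, map_neg, map_neg] at h1
          linarith
    · rintro ⟨hη, hηE⟩
      obtain ⟨hη1, hη2⟩ := h.mem_invSet_iff.1 hη
      have hηt : ρ t η ∈ rootSet ρ := apply_mem_rootSet hη1.2 t
      by_cases hp : 0 < height (ρ t η)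
      · refine ⟨ρ t η, (hmemt _).2 ⟨h.mem_posRoots_iff.2 ⟨hηt, hp⟩, ?_⟩, ?_⟩
        · rwa [h.reflOf_apply_reflOf_apply hbr]
        · simp only [f, ht, h.reflOf_apply_reflOf_apply hbr, if_pos (h.height_pos hη1)]
      · have hp' := h.height_neg_of_not_pos hηt hp
        refine ⟨η, (hmemt _).2 ⟨hη1, ?_⟩, by simp only [f, if_neg hp]⟩
        by_contra hcon
        have h1 := h.height_pos_of_not_neg (apply_mem_rootSet hηt u⁻¹) hcon
        refine hηE ⟨hη, ?_⟩
        rw [hneg, h.mem_invSet_iff, h.mem_posRoots_iff, map_neg, map_neg, map_neg]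
        exact ⟨⟨h.neg_mem_rootSet hηt, by linarith⟩, by linarith⟩
  have hinj : Set.InjOn f (invSet ρ (t * u)) := by
    intro c hc d hd hcd
    have hcpos := h.height_pos hc.1
    have hdpos := h.height_pos hd.1
    simp only [f] at hcd
    split_ifs at hcd with h1 h2 h2
    · exact (ρ t).injective hcd
    · rw [← hcd, h.reflOf_apply_reflOf_apply hbr] at h2
      exact absurd hcpos h2
    · rw [hcd, h.reflOf_apply_reflOf_apply hbr] at h1
      exact absurd hdpos h1
    · exact hcd
  have hEsub : E ⊆ invSet ρ u := fun η hη => hη.1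
  rw [← h.ncard_invSet u, ← h.ncard_invSet (t * u), ← hinj.ncard_image, himg,
    Set.ncard_sdiff_add_ncard_of_subset hEsub (h.finite_invSet u)]

lemma length_reflOf_mul_lt (h : IsGeomRep cs ρ) {u : W} {b : S → ℝ} (hb : b ∈ invSet ρ u) :
    cs.length (reflOf M ρ b * u) < cs.length u := by
  rw [h.length_eq_length_reflOf_mul_add hb]
  have hmem : b ∈ {η ∈ invSet ρ u | (2 * bform M b η) • b - η ∈ invSet ρ u} := by
    refine ⟨hb, ?_⟩
    rw [h.bform_self hb.1.2, show (2 * (1 : ℝ)) • b - b = b by module]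
    exact hb
  have := (Set.ncard_pos ((h.finite_invSet u).subset fun η hη => hη.1)).2 ⟨b, hmem⟩
  omega

lemma mem_invSet_iff_length_lt (h : IsGeomRep cs ρ) {u : W} {b : S → ℝ} (hb : b ∈ posRoots ρ) :
    b ∈ invSet ρ u ↔ cs.length (reflOf M ρ b * u) < cs.length u := by
  refine ⟨h.length_reflOf_mul_lt, fun hlt => ?_⟩
  by_contra hcon
  have h1 : 0 < height (ρ u⁻¹ b) := h.height_pos_of_not_neg (apply_mem_rootSet hb.2 _)
    fun h1 => hcon (h.mem_invSet_iff.2 ⟨hb, h1⟩)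
  have h2 : b ∈ invSet ρ (reflOf M ρ b * u) := by
    rw [h.mem_invSet_iff, mul_inv_rev, h.inv_reflOf hb.2, rho_mul_apply, h.reflOf_apply_self hb.2,
      map_neg, map_neg]
    exact ⟨hb, by linarith⟩
  have h3 := h.length_reflOf_mul_lt h2
  rw [h.reflOf_mul_cancel_left hb.2] at h3
  omega

lemma mem_nOne_iff_length (h : IsGeomRep cs ρ) {w : W} {b : S → ℝ} :
    b ∈ nOne cs ρ w ↔ b ∈ posRoots ρ ∧ cs.length (reflOf M ρ b * w) + 1 = cs.length w := by
  refine and_congr_right fun hb => ⟨?_, fun hl => ⟨_, h.isReflIn_reflOf hb.2, hl⟩⟩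
  rintro ⟨t, ht, hl⟩
  rwa [← h.eq_reflOf hb.2 ht]

lemma nOne_subset_invSet (h : IsGeomRep cs ρ) (w : W) : nOne cs ρ w ⊆ invSet ρ w := by
  intro b hb
  obtain ⟨h1, h2⟩ := h.mem_nOne_iff_length.1 hb
  rw [h.mem_invSet_iff_length_lt h1]
  omega

lemma mem_nOne_iff (h : IsGeomRep cs ρ) {w : W} {b : S → ℝ} :
    b ∈ nOne cs ρ w ↔ b ∈ invSet ρ w ∧
      ∀ η ∈ invSet ρ w, (2 * bform M b η) • b - η ∈ invSet ρ w → η = b := by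
  have hfin : ∀ b, {η ∈ invSet ρ w | (2 * bform M b η) • b - η ∈ invSet ρ w}.Finite :=
    fun b => (h.finite_invSet w).subset fun η hη => hη.1
  have hmem : b ∈ invSet ρ w →
      b ∈ {η ∈ invSet ρ w | (2 * bform M b η) • b - η ∈ invSet ρ w} := by
    refine fun hb => ⟨hb, ?_⟩
    rw [h.bform_self hb.1.2, show (2 * (1 : ℝ)) • b - b = b by module]
    exact hb
  constructor
  · intro hb
    have hb1 := h.nOne_subset_invSet w hb
    have hb2 := (h.mem_nOne_iff_length.1 hb).2
    refine ⟨hb1, fun η hη hη' => ?_⟩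
    have h1 := h.length_eq_length_reflOf_mul_add hb1
    have h2 : {η ∈ invSet ρ w | (2 * bform M b η) • b - η ∈ invSet ρ w}.ncard ≤ 1 := by omega
    exact (Set.ncard_le_one (hfin b)).1 h2 η ⟨hη, hη'⟩ b (hmem hb1)
  · rintro ⟨hb1, hb2⟩
    refine h.mem_nOne_iff_length.2 ⟨hb1.1, ?_⟩
    have h1 := h.length_eq_length_reflOf_mul_add hb1
    rw [Set.ncard_eq_one.2 ⟨b, ?_⟩] at h1
    · exact h1.symm
    · exact Set.eq_singleton_iff_unique_mem.2 ⟨hmem hb1, fun η hη => hb2 η hη.1 hη.2⟩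

/-! ### The weak order -/

lemma invSet_subset_iff_simple_mul (h : IsGeomRep cs ρ) {u w : W} {s : S}
    (hu : simpleRoot s ∈ invSet ρ u) (hw : simpleRoot s ∈ invSet ρ w) :
    invSet ρ u ⊆ invSet ρ w ↔ invSet ρ (cs.simple s * u) ⊆ invSet ρ (cs.simple s * w) := by
  have hns : ∀ {x : W}, simpleRoot s ∈ invSet ρ x →
      simpleRoot s ∉ invSet ρ (cs.simple s * x) := by
    intro x hx
    have := h.length_simple_mul_of_mem hx
    rw [h.mem_invSet_simple_iff, cs.simple_mul_simple_cancel_left]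
    omega
  constructor
  · intro huw b hb
    have hbs : b ≠ simpleRoot s := fun hbs => hns hu (hbs ▸ hb)
    have key := fun x : W => h.simple_apply_mem_invSet_iff hb.1 hbs (cs.simple s * x)
    simp only [cs.simple_mul_simple_cancel_left] at key
    exact (key w).1 (huw ((key u).2 hb))
  · intro huw b hb
    by_cases hbs : b = simpleRoot s
    · exact hbs ▸ hw
    · have key := h.simple_apply_mem_invSet_iff hb.1 hbs
      exact (key w).1 (huw ((key u).2 hb))

lemma weakLE_iff (h : IsGeomRep cs ρ) {u w : W} :
    WeakLE cs u w ↔ invSet ρ u ⊆ invSet ρ w := by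
  induction hn : cs.length u generalizing u w with
  | zero =>
    rw [cs.length_eq_zero_iff] at hn
    subst hn
    refine iff_of_true ⟨w, by simp, by simp⟩ ?_
    simp [h.invSet_one]
  | succ n ih =>
    have hu1 : u ≠ 1 := by
      rintro rfl
      simp at hn
    obtain ⟨s, hs⟩ := h.exists_simpleRoot_mem_invSet hu1
    have hl := h.length_simple_mul_of_mem hs
    have key : simpleRoot s ∈ invSet ρ w →
        (WeakLE cs u w ↔ WeakLE cs (cs.simple s * u) (cs.simple s * w)) := by
      intro hw
      have hlw := h.length_simple_mul_of_mem hw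
      refine exists_congr fun v => ?_
      rw [mul_assoc, mul_right_inj]
      exact and_congr_right fun _ => by omega
    constructor
    · intro huw
      have hw : simpleRoot s ∈ invSet ρ w := by
        obtain ⟨v, rfl, hlv⟩ := huw
        rw [h.mem_invSet_simple_iff, ← mul_assoc]
        have := cs.length_mul_le (cs.simple s * u) v
        omega
      rw [h.invSet_subset_iff_simple_mul hs hw, ← ih (by omega), ← key hw]
      exact huw
    · intro huw
      have hw := huw hs
      rwa [key hw, ih (by omega), ← h.invSet_subset_iff_simple_mul hs hw]

lemma eq_of_invSet_eq (h : IsGeomRep cs ρ) {u w : W} (huw : invSet ρ u = invSet ρ w) :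
    u = w := by
  obtain ⟨v, hv, hl⟩ := h.weakLE_iff.2 huw.subset
  have h1 : cs.length v = 0 := by
    have h2 := h.ncard_invSet u
    have h3 := h.ncard_invSet w
    rw [huw] at h2
    omega
  rw [cs.length_eq_zero_iff] at h1
  rw [hv, h1, mul_one]

end IsGeomRep

/-! ### The set `N¹(w)` and the extreme rays of `cone(N(w))` -/

namespace IsGeomRep

lemma eq_of_eq_smul_of_pos (h : IsGeomRep cs ρ) {b c : S → ℝ} (hb : b ∈ posRoots ρ)
    (hc : c ∈ posRoots ρ) {x : ℝ} (hx : c = x • b) : c = b := by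
  rcases h.eq_or_eq_neg_of_eq_smul hb.2 hc.2 hx with h1 | h1
  · exact h1
  · have h2 := h.height_pos hb
    have h3 := h.height_pos hc
    rw [h1, map_neg] at h3
    linarith

/-- An element of `N¹(w)` is not a positive combination of two other inversions of `w`. -/
lemma ne_smul_add_smul_of_mem_nOne (h : IsGeomRep cs ρ) {w : W} {β γ₁ γ₂ : S → ℝ}
    (hβ : β ∈ nOne cs ρ w) (hγ₁ : γ₁ ∈ invSet ρ w) (hγ₂ : γ₂ ∈ invSet ρ w) (h1 : γ₁ ≠ β)
    (h2 : γ₂ ≠ β) {a b : ℝ} (ha : 0 < a) (hb : 0 < b) : β ≠ a • γ₁ + b • γ₂ := by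
  obtain ⟨hβN, hK⟩ := h.mem_nOne_iff.1 hβ
  have hβr := hβN.1.2
  obtain ⟨fβ, gβ⟩ := h.mem_invSet_iff.1 hβN
  replace fβ := h.height_pos fβ
  have refl_sign : ∀ γ ∈ invSet ρ w, γ ≠ β →
      height (γ - (2 * bform M β γ) • β) < 0 → height (ρ w⁻¹ (γ - (2 * bform M β γ) • β)) < 0 := by
    intro γ hγ hne hf
    have hr := h.sub_smul_mem_rootSet hβr hγ.1.2
    by_contra hcon
    refine hne (hK γ hγ ?_)
    have := h.height_pos_of_not_neg (apply_mem_rootSet hr _) hcon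
    rw [h.mem_invSet_iff, h.mem_posRoots_iff, ← neg_sub, map_neg, map_neg, map_neg]
    exact ⟨⟨h.neg_mem_rootSet hr, by linarith⟩, by linarith⟩
  have key : ∀ (γ₁ γ₂ : S → ℝ), γ₁ ∈ invSet ρ w → γ₂ ∈ invSet ρ w → γ₁ ≠ β → γ₂ ≠ β →
      ∀ a b : ℝ, 0 < a → 0 < b → β = a • γ₁ + b • γ₂ →
      height (γ₁ - (2 * bform M β γ₁) • β) < 0 → False := by
    intro γ₁ γ₂ hγ₁ hγ₂ h1 h2 a b ha hb hab hf1
    have hg1 := refl_sign γ₁ hγ₁ h1 hf1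
    have e1 := h.bform_self hβr
    have e2 := congrArg height hab
    have e3 := congrArg (fun v => height (ρ w⁻¹ v)) hab
    nth_rewrite 2 [hab] at e1
    have fγ₁ := h.height_pos hγ₁.1
    have fγ₂ := h.height_pos hγ₂.1
    have gγ₁ := (h.mem_invSet_iff.1 hγ₁).2
    have gγ₂ := (h.mem_invSet_iff.1 hγ₂).2
    have hs := refl_sign γ₂ hγ₂ h2
    have hne := h.height_ne_zero (h.sub_smul_mem_rootSet hβr hγ₂.1.2)
    simp only [map_add, map_sub, map_smul, smul_eq_mul, bform_add_right, bform_smul_right]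
      at e1 e2 e3 hs hf1 hg1 hne
    generalize height β = x at *
    generalize height (ρ w⁻¹ β) = y at *
    generalize height γ₁ = x₁ at *
    generalize height (ρ w⁻¹ γ₁) = y₁ at *
    generalize height γ₂ = x₂ at *
    generalize height (ρ w⁻¹ γ₂) = y₂ at *
    generalize bform M β γ₁ = B₁ at *
    generalize bform M β γ₂ = B₂ at *
    have hg2 : y₂ - 2 * B₂ * y > 0 := by
      have : a * (y₁ - 2 * B₁ * y) + b * (y₂ - 2 * B₂ * y) = -y := by
        linear_combination (-1 : ℝ) * e3 - 2 * y * e1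
      by_contra hcon
      nlinarith [mul_pos ha (neg_pos.2 hg1), mul_nonneg hb.le (sub_nonneg.2 (not_lt.1 hcon))]
    have hf2 : x₂ - 2 * B₂ * x > 0 := by
      by_contra hcon
      have := hs (lt_of_le_of_ne (not_lt.1 hcon) hne)
      linarith
    rcases le_or_gt 1 (2 * b * B₂) with hB | hB
    · have : b * (x₂ - 2 * B₂ * x) = -(a * x₁) - (2 * b * B₂ - 1) * x := by
        linear_combination (-1 : ℝ) * e2
      nlinarith [mul_pos hb hf2, mul_pos ha fγ₁, mul_nonneg (sub_nonneg.2 hB) fβ.le]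
    · have : a * (2 * B₁ * y - y₁) = (1 - 2 * b * B₂) * y + b * y₂ := by
        linear_combination e3 + 2 * y * e1
      nlinarith [mul_pos ha (sub_pos.2 hg1), mul_pos (sub_pos.2 hB) (neg_pos.2 gβ),
        mul_pos hb (neg_pos.2 gγ₂)]
  intro hab
  by_cases hf : height (γ₁ - (2 * bform M β γ₁) • β) < 0
  · exact key γ₁ γ₂ hγ₁ hγ₂ h1 h2 a b ha hb hab hf
  · refine key γ₂ γ₁ hγ₂ hγ₁ h2 h1 b a hb ha (by rw [hab, add_comm]) ?_
    have e1 := h.bform_self hβr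
    nth_rewrite 2 [hab] at e1
    have e2 := congrArg height hab
    simp only [map_add, map_sub, map_smul, smul_eq_mul, bform_add_right, bform_smul_right]
      at e1 e2 hf ⊢
    have : a * (height γ₁ - 2 * bform M β γ₁ * height β) +
        b * (height γ₂ - 2 * bform M β γ₂ * height β) = -height β := by
      linear_combination (-1 : ℝ) * e2 - 2 * height β * e1
    by_contra hcon
    nlinarith [mul_nonneg ha.le (not_lt.1 hf), mul_nonneg hb.le (not_lt.1 hcon)]

/-- The set `N¹(w)` determines `N(w)`. -/
lemma invSet_subset_of_nOne_subset (h : IsGeomRep cs ρ) {w w' : W}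
    (hsub : nOne cs ρ w ⊆ invSet ρ w') : invSet ρ w ⊆ invSet ρ w' := by
  intro β₀ hβ₀
  by_contra hβ₀'
  have hg0 : 0 < height (ρ w'⁻¹ β₀) := h.height_pos_of_not_neg (apply_mem_rootSet hβ₀.1.2 _)
    fun h1 => hβ₀' (h.mem_invSet_iff.2 ⟨hβ₀.1, h1⟩)
  obtain ⟨β₁, hβ₁, hmax₁⟩ := Set.exists_max_image (invSet ρ w)
    (fun β => height (ρ w'⁻¹ β) / height β) (h.finite_invSet w) ⟨β₀, hβ₀⟩
  set R := height (ρ w'⁻¹ β₁) / height β₁ with hR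
  have hRpos : 0 < R := lt_of_lt_of_le (div_pos hg0 (h.height_pos hβ₀.1)) (hmax₁ β₀ hβ₀)
  have hle : ∀ β ∈ invSet ρ w, height (ρ w'⁻¹ β) ≤ R * height β := fun β hβ =>
    (div_le_iff₀ (h.height_pos hβ.1)).1 (hmax₁ β hβ)
  obtain ⟨β, ⟨hβ, hβR⟩, hmax⟩ := Set.exists_max_image
    {β ∈ invSet ρ w | height (ρ w'⁻¹ β) = R * height β}
    (fun β => (∑ s, β s ^ 2) / height β ^ 2) ((h.finite_invSet w).subset fun β hβ => hβ.1)
    ⟨β₁, hβ₁, by rw [hR, div_mul_cancel₀ _ (h.height_pos hβ₁.1).ne']⟩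
  have fβ := h.height_pos hβ.1
  have hβ1 : β ∉ nOne cs ρ w := by
    intro h1
    have := (h.mem_invSet_iff.1 (hsub h1)).2
    rw [hβR] at this
    nlinarith [mul_pos hRpos fβ]
  rw [h.mem_nOne_iff, not_and] at hβ1
  have hβ2 := hβ1 hβ
  push Not at hβ2
  obtain ⟨η, hη, hη', hne⟩ := hβ2
  set k := 2 * bform M β η with hk
  set η' := k • β - η with hη'def
  have fη := h.height_pos hη.1
  have fη' := h.height_pos hη'.1
  have e1 : height η' = k * height β - height η := by simp [hη'def]
  have e2 : height (ρ w'⁻¹ η') = k * height (ρ w'⁻¹ β) - height (ρ w'⁻¹ η) := by simp [hη'def]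
  have r1 := hle η hη
  have r2 := hle η' hη'
  have hηA : height (ρ w'⁻¹ η) = R * height η := by
    rw [e2, e1, hβR] at r2
    linarith
  have hη'A : height (ρ w'⁻¹ η') = R * height η' := by
    rw [e2, e1, hηA, hβR]
    ring
  have m1 := hmax η ⟨hη, hηA⟩
  have m2 := hmax η' ⟨hη', hη'A⟩
  have e3 : k ^ 2 * ∑ s, β s ^ 2 = ∑ s, (η s + η' s) ^ 2 := by
    rw [Finset.mul_sum]
    refine Finset.sum_congr rfl fun s _ => ?_
    simp [hη'def]
    ring
  have e4 : ∑ s, (η s + η' s) ^ 2 = ∑ s, η s ^ 2 + ∑ s, η' s ^ 2 + 2 * ∑ s, η s * η' s := by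
    rw [Finset.mul_sum, ← Finset.sum_add_distrib, ← Finset.sum_add_distrib]
    exact Finset.sum_congr rfl fun s _ => by ring
  have e5 : ∑ s, (height η' * η s - height η * η' s) ^ 2 = height η' ^ 2 * ∑ s, η s ^ 2 +
      height η ^ 2 * ∑ s, η' s ^ 2 - 2 * (height η * height η') * ∑ s, η s * η' s := by
    rw [Finset.mul_sum, Finset.mul_sum, Finset.mul_sum, ← Finset.sum_add_distrib,
      ← Finset.sum_sub_distrib]
    exact Finset.sum_congr rfl fun s _ => by ring
  set Q := (∑ s, β s ^ 2) / height β ^ 2 with hQ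
  have hQ' : ∑ s, β s ^ 2 = Q * height β ^ 2 := by
    rw [hQ, div_mul_cancel₀ _ (by positivity)]
  rw [div_le_iff₀ (by positivity)] at m1 m2
  have e6 : (height η + height η') ^ 2 * Q = ∑ s, η s ^ 2 + ∑ s, η' s ^ 2 +
      2 * ∑ s, η s * η' s := by
    rw [← e4, ← e3, hQ', e1]
    ring
  have e7 : ∑ s, (height η' * η s - height η * η' s) ^ 2 ≤ 0 := by
    rw [e5]
    generalize ∑ s, η s ^ 2 = X at *
    generalize ∑ s, η' s ^ 2 = X' at *
    generalize ∑ s, η s * η' s = Y at *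
    generalize height η = a at *
    generalize height η' = a' at *
    have h3 : 2 * Y = (a + a') ^ 2 * Q - X - X' := by linarith
    have h4 : a' ^ 2 * X + a ^ 2 * X' - 2 * (a * a') * Y =
        (a' * (a' + a)) * (X - Q * a ^ 2) + (a * (a + a')) * (X' - Q * a' ^ 2) := by
      linear_combination (-(a * a')) * h3
    rw [h4]
    have : 0 ≤ a' * (a' + a) := by positivity
    have : 0 ≤ a * (a + a') := by positivity
    nlinarith
  have e8 : ∀ s, height η' * η s - height η * η' s = 0 := by
    intro s
    have h3 := (Finset.sum_eq_zero_iff_of_nonneg fun s _ => sq_nonneg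
      (height η' * η s - height η * η' s)).1 (le_antisymm e7
        (Finset.sum_nonneg fun s _ => sq_nonneg _)) s (Finset.mem_univ s)
    exact pow_eq_zero_iff two_ne_zero |>.1 h3
  have e9 : η' = (height η' / height η) • η := by
    ext s
    rw [Pi.smul_apply, smul_eq_mul]
    field_simp
    linarith [e8 s]
  have e10 : η' = η := h.eq_of_eq_smul_of_pos hη.1 hη'.1 e9
  refine hne (h.eq_of_eq_smul_of_pos hβ.1 hη.1 (x := k / 2) ?_)
  rw [hη'def] at e10
  have e11 : k • β = η + η := by
    nth_rewrite 2 [← e10]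
    module
  rw [div_eq_inv_mul, mul_smul, e11]
  module

lemma eq_of_nOne_eq (h : IsGeomRep cs ρ) {u w : W} (huw : nOne cs ρ u = nOne cs ρ w) :
    u = w := by
  apply h.eq_of_invSet_eq
  apply Set.Subset.antisymm
  · exact h.invSet_subset_of_nOne_subset (huw ▸ h.nOne_subset_invSet w)
  · exact h.invSet_subset_of_nOne_subset (huw ▸ h.nOne_subset_invSet u)

end IsGeomRep

/-! ### The dominance order -/

/-- The sequence `x, y, …` obtained by iterating `(a, b) ↦ (b, -s_b a)`, where
`k = B(x, y)`. -/
def rootChain {S : Type*} (k : ℝ) (x y : S → ℝ) : ℕ → S → ℝ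
  | 0 => x
  | 1 => y
  | n + 2 => (2 * k) • rootChain k x y (n + 1) - rootChain k x y n

lemma map_rootChain_add_two {S : Type*} (f : (S → ℝ) →ₗ[ℝ] ℝ) (k : ℝ) (x y : S → ℝ) (n : ℕ) :
    f (rootChain k x y (n + 2)) = 2 * k * f (rootChain k x y (n + 1)) - f (rootChain k x y n) := by
  simp [rootChain]

lemma one_le_of_recurrence {k : ℝ} {e : ℕ → ℝ} (hpos : ∀ n, 0 < e n)
    (hrec : ∀ n, e (n + 2) = 2 * k * e (n + 1) - e n) : 1 ≤ k := by
  by_contra! hk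
  have hq : ∀ n : ℕ, e (n + 1) / e n ≤ e 1 / e 0 - n * (2 - 2 * k) := by
    intro n
    induction n with
    | zero => simp
    | succ n ih =>
      have h0 := hpos n
      have h1 := hpos (n + 1)
      have : e (n + 1 + 1) / e (n + 1) = 2 * k - e n / e (n + 1) := by
        rw [hrec]
        field_simp
      have h2 : 2 ≤ e (n + 1) / e n + e n / e (n + 1) := by
        have : e (n + 1) / e n + e n / e (n + 1) - 2 =
            (e (n + 1) - e n) ^ 2 / (e n * e (n + 1)) := by
          field_simp
          ring
        have : 0 ≤ (e (n + 1) - e n) ^ 2 / (e n * e (n + 1)) := by positivity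
        linarith
      push_cast
      linarith
  obtain ⟨n, hn⟩ := exists_nat_gt (e 1 / e 0 / (2 - 2 * k))
  rw [div_lt_iff₀ (by linarith)] at hn
  have := hq n
  have := div_pos (hpos (n + 1)) (hpos n)
  linarith

lemma strictAnti_recurrence {k : ℝ} (hk : 1 ≤ k) {e : ℕ → ℝ} (h1 : e 1 < 0) (h01 : e 1 < e 0)
    (hrec : ∀ n, e (n + 2) = 2 * k * e (n + 1) - e n) (n : ℕ) :
    e (n + 1) < 0 ∧ e (n + 1) < e n := by
  induction n with
  | zero => exact ⟨h1, h01⟩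
  | succ n ih =>
    have h2 : e (n + 1 + 1) < e (n + 1) := by
      rw [hrec]
      nlinarith [mul_nonneg (sub_nonneg.2 hk) (neg_pos.2 ih.1).le]
    exact ⟨h2.trans ih.1, h2⟩

lemma monotone_recurrence {k : ℝ} (hk : 1 ≤ k) {e : ℕ → ℝ} (h0 : 0 < e 0) (h01 : e 0 ≤ e 1)
    (hrec : ∀ n, e (n + 2) = 2 * k * e (n + 1) - e n) (n : ℕ) :
    0 < e n ∧ e n ≤ e (n + 1) := by
  induction n with
  | zero => exact ⟨h0, h01⟩
  | succ n ih =>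
    have h1 : 0 < e (n + 1) := lt_of_lt_of_le ih.1 ih.2
    refine ⟨h1, ?_⟩
    rw [hrec]
    nlinarith [mul_nonneg (sub_nonneg.2 hk) h1.le]

namespace IsGeomRep

lemma rootChain_mem (h : IsGeomRep cs ρ) {x y : S → ℝ} (hx : x ∈ rootSet ρ) (hy : y ∈ rootSet ρ)
    (n : ℕ) : rootChain (bform M x y) x y n ∈ rootSet ρ ∧
      rootChain (bform M x y) x y (n + 1) ∈ rootSet ρ ∧
      bform M (rootChain (bform M x y) x y n) (rootChain (bform M x y) x y (n + 1)) =
        bform M x y := by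
  induction n with
  | zero => exact ⟨hx, hy, rfl⟩
  | succ n ih =>
    obtain ⟨h1, h2, h3⟩ := ih
    refine ⟨h2, ?_, ?_⟩
    · rw [rootChain]
      nth_rewrite 1 [← h3]
      rw [bform_comm]
      exact h.smul_sub_mem_rootSet h2 h1
    · rw [rootChain, bform_sub_right, bform_smul_right, h.bform_self h2,
        bform_comm (rootChain _ _ _ (n + 1)), h3]
      ring

lemma dominates_apply (_ : IsGeomRep cs ρ) {a b : S → ℝ} (hab : Dominates ρ a b) (w : W) :
    Dominates ρ (ρ w a) (ρ w b) := by
  intro u hu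
  rw [← rho_mul_apply] at hu ⊢
  exact hab _ hu

lemma dominates_neg (h : IsGeomRep cs ρ) {a b : S → ℝ} (ha : a ∈ rootSet ρ) (hb : b ∈ rootSet ρ)
    (hab : Dominates ρ a b) : Dominates ρ (-b) (-a) := by
  rw [h.dominates_iff ha hb] at hab
  rw [h.dominates_iff (h.neg_mem_rootSet hb) (h.neg_mem_rootSet ha)]
  intro w hw
  rw [map_neg, map_neg] at hw ⊢
  by_contra hcon
  have := hab w (h.height_neg_of_not_pos (apply_mem_rootSet hb w) (by linarith))
  linarith

lemma dominates_smul_sub (h : IsGeomRep cs ρ) {a b : S → ℝ} (ha : a ∈ rootSet ρ)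
    (hb : b ∈ rootSet ρ) (hab : Dominates ρ a b) :
    Dominates ρ b ((2 * bform M b a) • b - a) := by
  have h1 := h.dominates_apply (h.dominates_neg ha hb hab) (reflOf M ρ b)
  rwa [map_neg, map_neg, h.reflOf_apply_self hb, h.reflOf_apply hb, neg_neg, neg_sub] at h1

lemma smul_sub_dominates (h : IsGeomRep cs ρ) {a b : S → ℝ} (ha : a ∈ rootSet ρ)
    (hb : b ∈ rootSet ρ) (hba : Dominates ρ b a) :
    Dominates ρ ((2 * bform M b a) • b - a) b := by
  have h1 := h.dominates_apply (h.dominates_neg hb ha hba) (reflOf M ρ b)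
  rwa [map_neg, map_neg, h.reflOf_apply_self hb, h.reflOf_apply hb, neg_neg, neg_sub] at h1

lemma rootChain_dominates (h : IsGeomRep cs ρ) {x y : S → ℝ} (hx : x ∈ rootSet ρ)
    (hy : y ∈ rootSet ρ) (hxy : Dominates ρ x y) (n : ℕ) :
    Dominates ρ (rootChain (bform M x y) x y n) (rootChain (bform M x y) x y (n + 1)) := by
  induction n with
  | zero => exact hxy
  | succ n ih =>
    obtain ⟨h1, h2, h3⟩ := h.rootChain_mem hx hy n
    have := h.dominates_smul_sub h1 h2 ih
    rwa [bform_comm (rootChain _ _ _ (n + 1)), h3] at this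

lemma dominates_rootChain (h : IsGeomRep cs ρ) {x y : S → ℝ} (hx : x ∈ rootSet ρ)
    (hy : y ∈ rootSet ρ) (hyx : Dominates ρ y x) (n : ℕ) :
    Dominates ρ (rootChain (bform M x y) x y (n + 1)) (rootChain (bform M x y) x y n) := by
  induction n with
  | zero => exact hyx
  | succ n ih =>
    obtain ⟨h1, h2, h3⟩ := h.rootChain_mem hx hy n
    have := h.smul_sub_dominates h1 h2 ih
    rwa [bform_comm (rootChain _ _ _ (n + 1)), h3] at this

lemma one_le_bform_of_dominates (h : IsGeomRep cs ρ) {a b : S → ℝ} (ha : a ∈ posRoots ρ)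
    (hb : b ∈ posRoots ρ) (hab : Dominates ρ a b) : 1 ≤ bform M a b := by
  have hr := h.rootChain_mem ha.2 hb.2
  have hd := h.rootChain_dominates ha.2 hb.2 hab
  refine one_le_of_recurrence (e := fun n => height (rootChain (bform M a b) a b n)) ?_
    (map_rootChain_add_two height _ a b)
  intro n
  induction n with
  | zero => exact h.height_pos ha
  | succ n ih =>
    refine h.height_pos_of_not_neg (hr n).2.1 fun hcon => ?_
    have := (h.dominates_iff (hr n).1 (hr n).2.1).1 (hd n) 1
    simp only [rho_one_apply] at this
    exact absurd (this hcon) (not_lt.2 ih.le)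

lemma height_lt_of_dominates_of_pos (h : IsGeomRep cs ρ) {a b : S → ℝ} (ha : a ∈ posRoots ρ)
    (hb : b ∈ posRoots ρ) (hab : Dominates ρ a b) (hne : a ≠ b) : height a < height b := by
  by_contra! hcon
  have hk : 1 ≤ bform M b a := by
    rw [bform_comm]
    exact h.one_le_bform_of_dominates ha hb hab
  have hr := h.rootChain_mem hb.2 ha.2
  have hd := h.dominates_rootChain hb.2 ha.2 hab
  have hrec := map_rootChain_add_two height (bform M b a) b a
  have hmono := monotone_recurrence (e := fun n => height (rootChain (bform M b a) b a n)) hk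
    (h.height_pos hb) hcon hrec
  have hda : ∀ n, Dominates ρ (rootChain (bform M b a) b a (n + 1)) a := by
    intro n
    induction n with
    | zero => exact fun w hw => hw
    | succ n ih => exact fun w hw => hd (n + 1) w (ih w hw)
  have hN : ∀ n, rootChain (bform M b a) b a (n + 1) ∈ invSet ρ (reflOf M ρ a) := by
    intro n
    refine h.mem_invSet_iff.2 ⟨h.mem_posRoots_iff.2 ⟨(hr n).2.1, (hmono (n + 1)).1⟩, ?_⟩
    refine (h.dominates_iff (hr n).2.1 ha.2).1 (hda n) _ ?_
    rw [h.inv_reflOf ha.2, h.reflOf_apply_self ha.2, map_neg]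
    have := h.height_pos ha
    linarith
  refine Set.infinite_of_injective_forall_mem (f := fun n => rootChain (bform M b a) b a (n + 1))
    ?_ hN (h.finite_invSet _)
  rcases hk.eq_or_lt with hk1 | hk1
  · rw [← hk1]
    have hlin : ∀ n : ℕ, rootChain 1 b a n = b + (n : ℝ) • (a - b) := by
      intro n
      induction n using Nat.twoStepInduction with
      | zero => simp [rootChain]
      | one => simp [rootChain]
      | more n h1 h2 =>
        rw [rootChain, h1, h2]
        push_cast
        module
    intro m n hmn
    simp only [hlin, add_right_inj] at hmn
    have := smul_left_injective ℝ (sub_ne_zero.2 hne) hmn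
    push_cast at this
    exact_mod_cast add_right_cancel this
  · have hsm : StrictMono fun n => height (rootChain (bform M b a) b a (n + 1)) := by
      refine strictMono_nat_of_lt_succ fun n => ?_
      rw [hrec]
      have h1 := hmono n
      have h2 := hmono (n + 1)
      nlinarith [mul_pos (sub_pos.2 hk1) h2.1]
    exact fun m n hmn => hsm.injective (congrArg height hmn)

lemma height_lt_of_dominates (h : IsGeomRep cs ρ) {a b : S → ℝ} (ha : a ∈ rootSet ρ)
    (hb : b ∈ rootSet ρ) (hab : Dominates ρ a b) (hne : a ≠ b) : height a < height b := by
  by_cases hb' : 0 < height b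
  · by_cases ha' : 0 < height a
    · exact h.height_lt_of_dominates_of_pos (h.mem_posRoots_iff.2 ⟨ha, ha'⟩)
        (h.mem_posRoots_iff.2 ⟨hb, hb'⟩) hab hne
    · have := h.height_neg_of_not_pos ha ha'
      linarith
  · have hb'' := h.height_neg_of_not_pos hb hb'
    have ha' := (h.dominates_iff ha hb).1 hab 1
    rw [rho_one_apply, rho_one_apply] at ha'
    have := h.height_lt_of_dominates_of_pos (a := -b) (b := -a)
      (h.mem_negRoots_iff.2 ⟨hb, hb''⟩) (h.mem_negRoots_iff.2 ⟨ha, ha' hb''⟩)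
      (h.dominates_neg ha hb hab) (fun h1 => hne (neg_injective h1).symm)
    rw [map_neg, map_neg] at this
    linarith

lemma dominates_of_one_le_bform (h : IsGeomRep cs ρ) {a b : S → ℝ} (ha : a ∈ posRoots ρ)
    (hb : b ∈ posRoots ρ) (hk : 1 ≤ bform M a b) (hab : height a ≤ height b) :
    Dominates ρ a b := by
  rw [h.dominates_iff ha.2 hb.2]
  intro x hxb
  by_contra hxa
  replace hxa := h.height_pos_of_not_neg (apply_mem_rootSet ha.2 x) hxa
  have hr := h.rootChain_mem ha.2 hb.2
  have hmono := monotone_recurrence (e := fun n => height (rootChain (bform M a b) a b n)) hk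
    (h.height_pos ha) hab (map_rootChain_add_two height _ a b)
  have hanti := strictAnti_recurrence
    (e := fun n => height (ρ x (rootChain (bform M a b) a b n))) hk hxb (hxb.trans hxa)
    (map_rootChain_add_two (height ∘ₗ (ρ x).toLinearMap) _ a b)
  refine Set.infinite_of_injective_forall_mem (f := fun n => rootChain (bform M a b) a b (n + 1))
    (s := invSet ρ x⁻¹) ?_ ?_ (h.finite_invSet _)
  · have hsa : StrictAnti fun n => height (ρ x (rootChain (bform M a b) a b n)) :=
      strictAnti_nat_of_succ_lt fun n => (hanti n).2
    intro m n hmn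
    exact Nat.succ_injective (hsa.injective (congrArg (fun v => height (ρ x v)) hmn))
  · intro n
    rw [h.mem_invSet_iff, inv_inv]
    exact ⟨h.mem_posRoots_iff.2 ⟨(hr n).2.1, (hmono (n + 1)).1⟩, (hanti n).1⟩

lemma isSmallRoot_iff (h : IsGeomRep cs ρ) {b : S → ℝ} :
    IsSmallRoot ρ b ↔ b ∈ posRoots ρ ∧
      ∀ a ∈ posRoots ρ, 1 ≤ bform M a b → height a ≤ height b → a = b := by
  refine and_congr_right fun hb => forall₂_congr fun a ha => ⟨fun h1 h2 h3 => ?_, fun h1 h2 => ?_⟩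
  · exact h1 (h.dominates_of_one_le_bform ha hb h2 h3)
  · by_contra hne
    exact hne (h1 (h.one_le_bform_of_dominates ha hb h2)
      (h.height_lt_of_dominates_of_pos ha hb h2 hne).le)

lemma exists_dominates_of_not_isSmallRoot (_ : IsGeomRep cs ρ) {b : S → ℝ} (hb : b ∈ posRoots ρ)
    (hns : ¬ IsSmallRoot ρ b) : ∃ a ∈ posRoots ρ, Dominates ρ a b ∧ a ≠ b := by
  unfold IsSmallRoot at hns
  push Not at hns
  exact hns hb

lemma simpleRoot_isSmallRoot (h : IsGeomRep cs ρ) (s : S) : IsSmallRoot ρ (simpleRoot s) := by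
  refine ⟨h.simpleRoot_mem_posRoots s, fun a ha hd => ?_⟩
  refine h.eq_simpleRoot_of_height_neg ha (s := s) ?_
  refine (h.dominates_iff ha.2 (simpleRoot_mem_rootSet ρ s)).1 hd _ ?_
  rw [h.simple_apply_self, map_neg, height_simpleRoot]
  norm_num

/-- Reflecting a positive root upwards preserves non-smallness. -/
lemma not_isSmallRoot_sub_smul (h : IsGeomRep cs ρ) {ζ γ : S → ℝ} (hζ : ζ ∈ posRoots ρ)
    (hns : ¬ IsSmallRoot ρ ζ) (hγ : γ ∈ posRoots ρ) (hB : bform M γ ζ < 0) :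
    ζ - (2 * bform M γ ζ) • γ ∈ posRoots ρ ∧ ¬ IsSmallRoot ρ (ζ - (2 * bform M γ ζ) • γ) := by
  have hfγ := h.height_pos hγ
  have hfζ := h.height_pos hζ
  have hup : height ζ < height (ζ - (2 * bform M γ ζ) • γ) := by
    rw [map_sub, map_smul, smul_eq_mul]
    nlinarith [mul_pos (neg_pos.2 hB) hfγ]
  have hpos : ζ - (2 * bform M γ ζ) • γ ∈ posRoots ρ :=
    h.mem_posRoots_iff.2 ⟨h.sub_smul_mem_rootSet hγ.2 hζ.2, by linarith⟩
  refine ⟨hpos, fun hs => ?_⟩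
  obtain ⟨δ, hδ, hδζ, hne⟩ := h.exists_dominates_of_not_isSmallRoot hζ hns
  by_cases hp : 0 < height (ρ (reflOf M ρ γ) δ)
  · have h1 := h.dominates_apply hδζ (reflOf M ρ γ)
    have h2 := hs.2 _ (h.mem_posRoots_iff.2 ⟨apply_mem_rootSet hδ.2 _, hp⟩) (by
      rwa [h.reflOf_apply hγ.2 ζ] at h1)
    rw [← h.reflOf_apply hγ.2 ζ] at h2
    exact hne ((ρ (reflOf M ρ γ)).injective h2)
  · have hfδ := h.height_pos hδ
    rw [h.reflOf_apply hγ.2, map_sub, map_smul, smul_eq_mul] at hp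
    have hBδ : 0 < bform M γ δ := by
      by_contra hcon
      nlinarith [mul_nonneg (neg_nonneg.2 (not_lt.1 hcon)) hfγ.le]
    have hlt := h.height_lt_of_dominates_of_pos hδ hζ hδζ hne
    have h1 := h.one_le_bform_of_dominates hδ hζ hδζ
    have h2 := (h.isSmallRoot_iff.1 hs).2 δ hδ (by
      rw [bform_sub_right, bform_smul_right, bform_comm δ γ]
      nlinarith [mul_pos (neg_pos.2 hB) hBδ]) (by linarith)
    rw [← h2] at hup
    linarith

end IsGeomRep

/-! ### Finite rank two subsystems -/

/-- Some positive multiple of `2ω` is close to a multiple of `2π`. -/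
lemma exists_abs_sin_mul_lt_cos (ω H : ℝ) :
    ∃ n : ℕ, 0 < n ∧ |Real.sin (n * (2 * ω)) * H| < Real.cos (n * (2 * ω)) := by
  have hpi := Real.pi_pos
  obtain ⟨N, hN⟩ := exists_nat_gt (2 * Real.pi * (2 * (|H| + 1)))
  have hHpos : 0 < |H| + 1 := by positivity
  have hN0 : 0 < N := by
    have : (0 : ℝ) < N := lt_trans (by positivity) hN
    exact_mod_cast this
  obtain ⟨n, hn, -, hle⟩ := Real.exists_nat_abs_mul_sub_round_le (ω / Real.pi) hN0
  refine ⟨n, hn, ?_⟩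
  set k := round (n * (ω / Real.pi))
  set d := n * (ω / Real.pi) - k with hd
  have hx : (n : ℝ) * (2 * ω) = 2 * Real.pi * d + k * (2 * Real.pi) := by
    rw [hd]
    field_simp
    ring
  rw [hx, Real.sin_add_int_mul_two_pi, Real.cos_add_int_mul_two_pi, abs_mul]
  have h1 : |2 * Real.pi * d| * (2 * (|H| + 1)) < 1 := by
    rw [abs_mul, abs_of_pos (by positivity : 0 < 2 * Real.pi)]
    have h2 : |d| * (N + 1) ≤ 1 := by
      rwa [le_div_iff₀ (by positivity)] at hle
    have h3 : |d| * (2 * Real.pi * (2 * (|H| + 1))) ≤ |d| * N :=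
      mul_le_mul_of_nonneg_left hN.le (abs_nonneg d)
    rcases (abs_nonneg d).eq_or_lt with h4 | h4
    · rw [← h4]
      norm_num
    · nlinarith
  set y := 2 * Real.pi * d
  have h2 := Real.one_sub_sq_div_two_le_cos (x := y)
  have h3 := Real.abs_sin_le_abs (x := y)
  have h4 : |y| ≤ 1 / 2 := by nlinarith [abs_nonneg y, abs_nonneg H]
  have h5 : |Real.sin y| * |H| ≤ |y| * |H| := mul_le_mul_of_nonneg_right h3 (abs_nonneg H)
  have h6 : y ^ 2 = |y| ^ 2 := (sq_abs y).symm
  nlinarith [abs_nonneg y, abs_nonneg H]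

namespace IsGeomRep

/-- Two roots with `|B(α, β)| < 1`, one of them simple, generate a finite reflection group. -/
lemma exists_pow_eq_one (h : IsGeomRep cs ρ) {s : S} {β : S → ℝ} (hβ : β ∈ rootSet ρ)
    (hB : |bform M (simpleRoot s) β| < 1) :
    ∃ m : ℕ, 0 < m ∧ (cs.simple s * reflOf M ρ β) ^ m = 1 := by
  obtain ⟨hc1, hc2⟩ := abs_lt.1 hB
  set α := simpleRoot s with hα
  set R := cs.simple s * reflOf M ρ β with hR
  set ω := Real.arccos (bform M α β) with hω
  have hcos : Real.cos ω = bform M α β := Real.cos_arccos hc1.le hc2.le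
  have hsin : 0 < Real.sin ω := Real.sin_pos_of_pos_of_lt_pi (Real.arccos_pos.2 hc2)
    (lt_of_le_of_ne (Real.arccos_le_pi _) fun h1 => by
      rw [Real.arccos_eq_pi] at h1
      linarith)
  have hsc := Real.sin_sq_add_cos_sq ω
  have hαα : bform M α α = 1 := bform_simpleRoot_self s
  have hββ := h.bform_self hβ
  set p := (Real.sin ω)⁻¹ • (β - Real.cos ω • α) with hp
  have hβp : β = Real.cos ω • α + Real.sin ω • p := by
    rw [hp, smul_smul, mul_inv_cancel₀ hsin.ne']
    module
  have hαp : bform M α p = 0 := by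
    rw [hp, bform_smul_right, bform_sub_right, bform_smul_right, hαα, hcos]
    ring
  have hpp : bform M p p = 1 := by
    have h1 := hββ
    rw [hβp] at h1
    simp only [bform_add_left, bform_add_right, bform_smul_left, bform_smul_right, hαα, hαp,
      bform_comm p α] at h1
    have h2 : Real.sin ω ^ 2 * (bform M p p - 1) = 0 := by linear_combination h1 - hsc
    rcases mul_eq_zero.1 h2 with h3 | h3
    · exact absurd h3 (by positivity)
    · linarith
  have hRv : ∀ v, ρ R v = v - (2 * bform M β v) • β -
      (2 * (bform M α v - 2 * bform M β v * bform M α β)) • α := by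
    intro v
    rw [hR, rho_mul_apply, h.reflOf_apply hβ, h.simple_apply, bform_sub_right, bform_smul_right]
  clear_value R p
  have hβα : bform M β α = Real.cos ω := by rw [bform_comm, hcos]
  have hβpv : bform M β p = Real.sin ω := by
    rw [hβp]
    simp only [bform_add_left, bform_smul_left, hαp, hpp]
    ring
  have hRα : ρ R α = Real.cos (2 * ω) • α - Real.sin (2 * ω) • p := by
    rw [hRv, hβα, hαα, ← hcos, Real.cos_two_mul, Real.sin_two_mul]
    nth_rewrite 1 [hβp]
    module
  have hRp : ρ R p = Real.sin (2 * ω) • α + Real.cos (2 * ω) • p := by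
    rw [hRv, hβpv, hαp, ← hcos, Real.cos_two_mul', Real.sin_two_mul]
    nth_rewrite 1 [hβp]
    have : Real.cos ω ^ 2 = 1 - Real.sin ω ^ 2 := by linarith
    rw [this]
    module
  have hRn : ∀ n : ℕ,
      ρ (R ^ n) α = Real.cos (n * (2 * ω)) • α - Real.sin (n * (2 * ω)) • p ∧
      ρ (R ^ n) p = Real.sin (n * (2 * ω)) • α + Real.cos (n * (2 * ω)) • p := by
    intro n
    induction n with
    | zero => simp
    | succ n ih =>
      have e : ((n + 1 : ℕ) : ℝ) * (2 * ω) = n * (2 * ω) + 2 * ω := by push_cast; ring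
      rw [pow_succ, rho_mul_apply, rho_mul_apply, hRα, hRp, map_sub, map_add, map_smul, map_smul,
        map_smul, map_smul, ih.1, ih.2, e, Real.cos_add, Real.sin_add]
      constructor <;> module
  obtain ⟨n, hn, hlt⟩ := exists_abs_sin_mul_lt_cos ω (height p)
  refine ⟨n, hn, ?_⟩
  obtain ⟨hRnα, hRnp⟩ := hRn n
  set c := Real.cos (n * (2 * ω))
  set d := Real.sin (n * (2 * ω))
  obtain ⟨l1, l2⟩ := abs_lt.1 hlt
  have hs : ρ (cs.simple s) p = p := by
    rw [h.simple_apply, ← hα, hαp]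
    module
  have hfix : ρ (R ^ n) α = α := by
    refine h.eq_simpleRoot_of_height_neg (h.mem_posRoots_iff.2
      ⟨apply_mem_rootSet (simpleRoot_mem_rootSet ρ s) _, ?_⟩) ?_
    · rw [hRnα, map_sub, map_smul, map_smul, hα, height_simpleRoot, smul_eq_mul, smul_eq_mul]
      linarith
    · rw [hRnα, map_sub, map_smul, map_smul, hs, hα, h.simple_apply_self, map_sub, map_smul,
        map_smul, map_neg, height_simpleRoot, smul_eq_mul, smul_eq_mul]
      linarith
  have hc : c = 1 := by
    have := congrArg (bform M α) (hRnα.symm.trans hfix)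
    rwa [bform_sub_right, bform_smul_right, bform_smul_right, hαα, hαp, mul_zero, sub_zero,
      mul_one] at this
  have hd : d = 0 := by
    have := congrArg (bform M p) (hRnα.symm.trans hfix)
    rw [bform_sub_right, bform_smul_right, bform_smul_right, bform_comm p α, hpp, hαp] at this
    linarith
  refine h.eq_of_apply_eq fun v => ?_
  set v' := v - bform M α v • α - bform M p v • p with hv'
  have hv : v = v' + bform M α v • α + bform M p v • p := by
    rw [hv']
    module
  have o1 : bform M α v' = 0 := by
    rw [hv']
    simp only [bform_sub_right, bform_smul_right, hαα, hαp]
    ring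
  have o2 : bform M p v' = 0 := by
    rw [hv']
    simp only [bform_sub_right, bform_smul_right, hpp, hαp, bform_comm p α]
    ring
  have o3 : bform M β v' = 0 := by
    rw [hβp, bform_add_left, bform_smul_left, bform_smul_left, o1, o2]
    ring
  have hRv' : ∀ j : ℕ, ρ (R ^ j) v' = v' := by
    intro j
    induction j with
    | zero => simp
    | succ j ih =>
      rw [pow_succ, rho_mul_apply, hRv, o1, o3]
      simpa using ih
  rw [rho_one_apply, hv, map_add, map_add, map_smul, map_smul, hRv', hfix, hRnp, hc, hd]
  module

end IsGeomRep

/-! ### Points of the Tits cone -/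

/-- A linear functional behaving like a point of the interior of the Tits cone: it is positive
on almost all positive roots and strictly monotone for dominance. -/
structure IsTitsPoint (ρ : W →* ((S → ℝ) ≃ₗ[ℝ] (S → ℝ))) (f : (S → ℝ) →ₗ[ℝ] ℝ) : Prop where
  finite : {b ∈ posRoots ρ | f b ≤ 0}.Finite
  lt_of_dominates : ∀ a ∈ rootSet ρ, ∀ b ∈ rootSet ρ, Dominates ρ a b → a ≠ b → f a < f b

lemma IsTitsPoint.add {f g : (S → ℝ) →ₗ[ℝ] ℝ} (hf : IsTitsPoint ρ f) (hg : IsTitsPoint ρ g) :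
    IsTitsPoint ρ (f + g) := by
  refine ⟨(hf.finite.union hg.finite).subset fun b hb => ?_, fun a ha b hb hab hne => ?_⟩
  · have h1 := hb.2
    rw [LinearMap.add_apply] at h1
    by_cases h2 : f b ≤ 0
    · exact Or.inl ⟨hb.1, h2⟩
    · exact Or.inr ⟨hb.1, by linarith⟩
  · have h1 := hf.lt_of_dominates a ha b hb hab hne
    have h2 := hg.lt_of_dominates a ha b hb hab hne
    rw [LinearMap.add_apply, LinearMap.add_apply]
    linarith

namespace IsGeomRep

lemma isTitsPoint_height (h : IsGeomRep cs ρ) : IsTitsPoint ρ height := by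
  refine ⟨Set.finite_empty.subset fun b hb => ?_, fun a ha b hb => h.height_lt_of_dominates ha hb⟩
  exact absurd (h.height_pos hb.1) (not_lt.2 hb.2)

lemma isTitsPoint_comp (h : IsGeomRep cs ρ) {f : (S → ℝ) →ₗ[ℝ] ℝ} (hf : IsTitsPoint ρ f)
    (w : W) : IsTitsPoint ρ (f ∘ₗ (ρ w).toLinearMap) := by
  refine ⟨((hf.finite.preimage (ρ w).injective.injOn).union (h.finite_invSet w⁻¹)).subset
    fun b hb => ?_, fun a ha b hb hab hne => ?_⟩
  · have hr := apply_mem_rootSet hb.1.2 w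
    by_cases hp : 0 < height (ρ w b)
    · exact Or.inl ⟨h.mem_posRoots_iff.2 ⟨hr, hp⟩, hb.2⟩
    · refine Or.inr (h.mem_invSet_iff.2 ⟨hb.1, ?_⟩)
      rw [inv_inv]
      exact h.height_neg_of_not_pos hr hp
  · exact hf.lt_of_dominates _ (apply_mem_rootSet ha w) _ (apply_mem_rootSet hb w)
      (h.dominates_apply hab w) fun h1 => hne ((ρ w).injective h1)

lemma exists_isTitsPoint (h : IsGeomRep cs ρ) {s : S} {β : S → ℝ} (hβ : β ∈ rootSet ρ)
    (hB : |bform M (simpleRoot s) β| < 1) :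
    ∃ f, IsTitsPoint ρ f ∧ f (simpleRoot s) = 0 ∧ f β = 0 := by
  obtain ⟨m, hm, hR⟩ := h.exists_pow_eq_one hβ hB
  set R := cs.simple s * reflOf M ρ β with hRdef
  refine ⟨∑ i ∈ Finset.range m, (height ∘ₗ (ρ (R ^ i)).toLinearMap +
    height ∘ₗ (ρ (R ^ i * cs.simple s)).toLinearMap), ?_, ?_, ?_⟩
  · refine Finset.sum_induction_nonempty _ (IsTitsPoint ρ) (fun f g => IsTitsPoint.add)
      (Finset.nonempty_range_iff.2 hm.ne') fun i _ => ?_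
    exact (h.isTitsPoint_comp h.isTitsPoint_height _).add
      (h.isTitsPoint_comp h.isTitsPoint_height _)
  · rw [LinearMap.sum_apply]
    refine Finset.sum_eq_zero fun i _ => ?_
    simp [h.simple_apply_self]
  · have hs : ρ (cs.simple s) β = -ρ R β := by
      rw [hRdef, rho_mul_apply, h.reflOf_apply_self hβ, map_neg, neg_neg]
    have hterm : ∀ i : ℕ, (height ∘ₗ (ρ (R ^ i)).toLinearMap +
        height ∘ₗ (ρ (R ^ i * cs.simple s)).toLinearMap) β =
        height (ρ (R ^ i) β) - height (ρ (R ^ (i + 1)) β) := by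
      intro i
      rw [pow_succ, rho_mul_apply]
      simp [hs]
      ring
    rw [LinearMap.sum_apply, Finset.sum_congr rfl fun i _ => hterm i, Finset.sum_range_sub', hR,
      pow_zero, sub_self]

/-- Every Tits point can be moved into the closed fundamental chamber. -/
lemma exists_apply_nonneg (h : IsGeomRep cs ρ) {f : (S → ℝ) →ₗ[ℝ] ℝ} (hf : IsTitsPoint ρ f) :
    ∃ y : W, ∀ r, 0 ≤ f (ρ y (simpleRoot r)) := by
  induction hn : {b ∈ posRoots ρ | f b < 0}.ncard using Nat.strong_induction_on generalizing f with
  | _ n ih =>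
  by_cases hr : ∃ r, f (simpleRoot r) < 0
  · obtain ⟨r, hr⟩ := hr
    have hfin : {b ∈ posRoots ρ | f b < 0}.Finite :=
      hf.finite.subset fun b hb => ⟨hb.1, le_of_lt hb.2⟩
    have hmem : simpleRoot r ∈ {b ∈ posRoots ρ | f b < 0} := ⟨h.simpleRoot_mem_posRoots r, hr⟩
    obtain ⟨y, hy⟩ := ih _ (by
      rw [← hn, ← Set.ncard_image_of_injective _ (ρ (cs.simple r)).injective]
      refine Set.ncard_lt_ncard (t := {b ∈ posRoots ρ | f b < 0}) ⟨?_, fun hsub => ?_⟩ hfin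
      · rintro _ ⟨b, hb, rfl⟩
        refine ⟨h.simple_apply_mem_posRoots hb.1 ?_, hb.2⟩
        rintro rfl
        have h1 := hb.2
        simp [h.simple_apply_self] at h1
        linarith
      · obtain ⟨b, hb, hbr⟩ := hsub hmem
        exact h.simple_apply_ne hb.1 r hbr) (h.isTitsPoint_comp hf (cs.simple r)) rfl
    exact ⟨cs.simple r * y, fun t => by simpa [rho_mul_apply] using hy t⟩
  · push Not at hr
    exact ⟨1, fun r => by simpa [rho_one_apply] using hr r⟩

lemma apply_eq_sum (f : (S → ℝ) →ₗ[ℝ] ℝ) (v : S → ℝ) :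
    f v = ∑ s, v s * f (simpleRoot s) := by
  conv_lhs => rw [eq_sum_smul_simpleRoot v]
  simp

/-- The roots supported in `J`. -/
def parabolicRoots (ρ : W →* ((S → ℝ) ≃ₗ[ℝ] (S → ℝ))) (J : Set S) : Set (S → ℝ) :=
  {b ∈ rootSet ρ | ∀ r ∉ J, b r = 0}

lemma exists_parabolicRoots (h : IsGeomRep cs ρ) {f : (S → ℝ) →ₗ[ℝ] ℝ} (hf : IsTitsPoint ρ f) :
    ∃ (y : W) (J : Set S), (parabolicRoots ρ J).Finite ∧
      ∀ b ∈ rootSet ρ, f b = 0 → ρ y b ∈ parabolicRoots ρ J := by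
  obtain ⟨y, hy⟩ := h.exists_apply_nonneg hf
  set J := {r | f (ρ y (simpleRoot r)) = 0} with hJ
  have hsum : ∀ v, f (ρ y v) = ∑ r, v r * f (ρ y (simpleRoot r)) := fun v =>
    apply_eq_sum (f ∘ₗ (ρ y).toLinearMap) v
  refine ⟨y⁻¹, J, ?_, fun b hb hfb => ⟨apply_mem_rootSet hb _, fun r hr => ?_⟩⟩
  · have hfin : {b ∈ rootSet ρ | f b = 0}.Finite := by
      refine (hf.finite.union (hf.finite.image fun b => -b)).subset fun b hb => ?_
      by_cases hp : 0 < height b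
      · exact Or.inl ⟨h.mem_posRoots_iff.2 ⟨hb.1, hp⟩, hb.2.le⟩
      · refine Or.inr ⟨-b, ⟨h.mem_negRoots_iff.2 ⟨hb.1, h.height_neg_of_not_pos hb.1 hp⟩, ?_⟩,
          neg_neg b⟩
        rw [map_neg, hb.2, neg_zero]
    refine (hfin.preimage (ρ y).injective.injOn).subset fun b hb => ?_
    refine ⟨apply_mem_rootSet hb.1 y, ?_⟩
    rw [hsum]
    refine Finset.sum_eq_zero fun r _ => ?_
    by_cases hr : r ∈ J
    · rw [show f (ρ y (simpleRoot r)) = 0 from hr, mul_zero]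
    · rw [hb.2 r hr, zero_mul]
  · have h1 := hsum (ρ y⁻¹ b)
    rw [rho_apply_inv_apply, hfb] at h1
    have hpos : 0 < f (ρ y (simpleRoot r)) := lt_of_le_of_ne (hy r) (Ne.symm hr)
    have h2 : ρ y⁻¹ b r * f (ρ y (simpleRoot r)) = 0 := by
      rcases h.nonneg_or_nonpos (apply_mem_rootSet hb y⁻¹) with h3 | h3
      · exact (Finset.sum_eq_zero_iff_of_nonneg fun t _ => mul_nonneg (h3 t) (hy t)).1 h1.symm r
          (Finset.mem_univ r)
      · exact (Finset.sum_eq_zero_iff_of_nonpos fun t _ =>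
          mul_nonpos_of_nonpos_of_nonneg (h3 t) (hy t)).1 h1.symm r (Finset.mem_univ r)
    exact (mul_eq_zero.1 h2).resolve_right hpos.ne'

/-- Only finitely many values `B(α_s, β)` with `β` a root lie in the interval `(-1, 1)`. -/
lemma finite_bform_values (h : IsGeomRep cs ρ) :
    {x : ℝ | |x| < 1 ∧ ∃ s, ∃ β ∈ rootSet ρ, x = bform M (simpleRoot s) β}.Finite := by
  have hfin : (⋃ J ∈ {J : Set S | (parabolicRoots ρ J).Finite},
      Set.image2 (bform M) (parabolicRoots ρ J) (parabolicRoots ρ J)).Finite :=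
    (Set.toFinite _).biUnion fun J hJ => Set.Finite.image2 _ hJ hJ
  refine hfin.subset ?_
  rintro x ⟨hx, s, β, hβ, rfl⟩
  obtain ⟨f, hf, hfs, hfβ⟩ := h.exists_isTitsPoint hβ hx
  obtain ⟨y, J, hJ, hyJ⟩ := h.exists_parabolicRoots hf
  refine Set.mem_biUnion hJ ⟨_, hyJ _ (simpleRoot_mem_rootSet ρ s) hfs, _, hyJ _ hβ hfβ, ?_⟩
  exact h.bform_apply y _ _

end IsGeomRep

/-! ### Finiteness of the set of small roots -/

lemma bform_eq_sum (v u : S → ℝ) : bform M v u = ∑ s, v s * bform M (simpleRoot s) u := by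
  let f : (S → ℝ) →ₗ[ℝ] ℝ :=
    { toFun := fun v => bform M v u
      map_add' := fun _ _ => bform_add_left _ _ _
      map_smul' := fun _ _ => bform_smul_left _ _ _ }
  exact IsGeomRep.apply_eq_sum f v

lemma bform_simpleRoot_nonpos {s t : S} (hst : s ≠ t) :
    bform M (simpleRoot s) (simpleRoot t) ≤ 0 := by
  rw [bform_simpleRoot_simpleRoot]
  split_ifs with h0
  · norm_num
  · have h1 : M s t ≠ 1 := M.off_diagonal s t hst
    have h2 : (2 : ℝ) ≤ M s t := by
      have : 2 ≤ M s t := by omega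
      exact_mod_cast this
    rw [neg_nonpos]
    refine Real.cos_nonneg_of_neg_pi_div_two_le_of_le ?_ ?_
    · have : 0 ≤ Real.pi / (M s t : ℝ) := by positivity
      linarith [Real.pi_pos]
    · exact div_le_div_of_nonneg_left Real.pi_pos.le two_pos h2

/-- The capped values `max (B(α_s, b)) (-1)`. -/
noncomputable def rootState (M : CoxeterMatrix S) (b : S → ℝ) : S → ℝ :=
  fun s => max (bform M (simpleRoot s) b) (-1)

/-- The small roots of depth `n + 1`. -/
def smallLevel (cs : CoxeterSystem M W) (ρ : W →* ((S → ℝ) ≃ₗ[ℝ] (S → ℝ))) : ℕ → Set (S → ℝ)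
  | 0 => Set.range simpleRoot
  | n + 1 => {b | IsSmallRoot ρ b ∧ ∃ b' ∈ smallLevel cs ρ n, ∃ r,
      -1 < bform M (simpleRoot r) b' ∧ bform M (simpleRoot r) b' < 0 ∧ b = ρ (cs.simple r) b'}

/-- `y` is obtained from `x` by increasing coordinates without touching the coordinates `s`
with `B(α_s, x) ≤ -1`. -/
structure IsRaise (M : CoxeterMatrix S) (x y : S → ℝ) : Prop where
  le : ∀ s, x s ≤ y s
  height_lt : height x < height y
  frozen : ∀ s, bform M (simpleRoot s) x ≤ -1 → bform M (simpleRoot s) y ≤ -1 ∧ y s = x s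

lemma IsRaise.trans {x y z : S → ℝ} (hxy : IsRaise M x y) (hyz : IsRaise M y z) :
    IsRaise M x z where
  le s := (hxy.le s).trans (hyz.le s)
  height_lt := hxy.height_lt.trans hyz.height_lt
  frozen s hs := by
    obtain ⟨h1, h2⟩ := hxy.frozen s hs
    obtain ⟨h3, h4⟩ := hyz.frozen s h1
    exact ⟨h3, h4.trans h2⟩

namespace IsGeomRep

lemma bform_simpleRoot_lt_one (h : IsGeomRep cs ρ) {b : S → ℝ} (hb : IsSmallRoot ρ b) {s : S}
    (hbs : b ≠ simpleRoot s) : bform M (simpleRoot s) b < 1 := by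
  by_contra! h1
  rcases le_total (height (simpleRoot s)) (height b) with h2 | h2
  · exact hbs ((h.isSmallRoot_iff.1 hb).2 _ (h.simpleRoot_mem_posRoots s) h1 h2).symm
  · rw [bform_comm] at h1
    exact hbs ((h.isSmallRoot_iff.1 (h.simpleRoot_isSmallRoot s)).2 _ hb.1 h1 h2)

lemma exists_bform_pos (h : IsGeomRep cs ρ) {b : S → ℝ} (hb : b ∈ posRoots ρ) :
    ∃ r, 0 < bform M (simpleRoot r) b := by
  by_contra! hcon
  have h1 := h.bform_self hb.2
  rw [bform_eq_sum] at h1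
  have h2 : ∑ s, b s * bform M (simpleRoot s) b ≤ 0 := Finset.sum_nonpos fun s _ =>
    mul_nonpos_of_nonneg_of_nonpos (h.nonneg_of_mem_posRoots hb s) (hcon s)
  linarith

lemma isSmallRoot_simple_apply (h : IsGeomRep cs ρ) {b : S → ℝ} (hb : IsSmallRoot ρ b) {r : S}
    (hbr : b ≠ simpleRoot r) (hr : 0 < bform M (simpleRoot r) b) :
    IsSmallRoot ρ (ρ (cs.simple r) b) := by
  by_contra hns
  have h1 : bform M (simpleRoot r) (ρ (cs.simple r) b) = -bform M (simpleRoot r) b := by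
    rw [h.simple_apply, bform_sub_right, bform_smul_right, bform_simpleRoot_self]
    ring
  have h2 := h.not_isSmallRoot_sub_smul (h.simple_apply_mem_posRoots hb.1 hbr) hns
    (h.simpleRoot_mem_posRoots r) (by rw [h1]; linarith)
  rw [← h.simple_apply, h.simple_apply_simple_apply] at h2
  exact h2.2 hb

lemma isRaise_simple_apply (h : IsGeomRep cs ρ) {b : S → ℝ} {r : S}
    (h1 : -1 < bform M (simpleRoot r) b) (h2 : bform M (simpleRoot r) b < 0) :
    IsRaise M b (ρ (cs.simple r) b) := by
  rw [h.simple_apply]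
  refine ⟨fun s => ?_, ?_, fun s hs => ?_⟩
  · have := simpleRoot_nonneg r s
    simp only [Pi.sub_apply, Pi.smul_apply, smul_eq_mul]
    nlinarith
  · rw [map_sub, map_smul, height_simpleRoot, smul_eq_mul]
    linarith
  · have hsr : s ≠ r := by
      rintro rfl
      linarith
    constructor
    · rw [bform_sub_right, bform_smul_right]
      nlinarith [bform_simpleRoot_nonpos (M := M) hsr]
    · simp [simpleRoot_of_ne hsr]

lemma rootState_ne_of_isRaise (h : IsGeomRep cs ρ) {x y : S → ℝ} (hx : x ∈ posRoots ρ)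
    (hy : IsSmallRoot ρ y) (hxy : IsRaise M x y) : rootState M x ≠ rootState M y := by
  intro heq
  have hvv : bform M (y - x) (y - x) = 0 := by
    rw [bform_eq_sum]
    refine Finset.sum_eq_zero fun s _ => ?_
    by_cases hs : bform M (simpleRoot s) x ≤ -1
    · rw [Pi.sub_apply, (hxy.frozen s hs).2, sub_self, zero_mul]
    · push Not at hs
      have h1 := congrFun heq s
      simp only [rootState, max_eq_left hs.le] at h1
      rcases max_choice (bform M (simpleRoot s) y) (-1) with h2 | h2
      · rw [bform_sub_right, h1, h2, sub_self, mul_zero]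
      · linarith
  rw [bform_sub_left, bform_sub_right, bform_sub_right, h.bform_self hx.2, h.bform_self hy.1.2,
    bform_comm y x] at hvv
  have := (h.isSmallRoot_iff.1 hy).2 x hx (by linarith) hxy.height_lt.le
  exact hxy.height_lt.ne (congrArg height this)

lemma isSmallRoot_of_mem_smallLevel (h : IsGeomRep cs ρ) {n : ℕ} {b : S → ℝ}
    (hb : b ∈ smallLevel cs ρ n) : IsSmallRoot ρ b := by
  cases n with
  | zero =>
    obtain ⟨s, rfl⟩ := hb
    exact h.simpleRoot_isSmallRoot s
  | succ n => exact hb.1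

lemma finite_smallLevel (_ : IsGeomRep cs ρ) (n : ℕ) : (smallLevel cs ρ n).Finite := by
  induction n with
  | zero => exact Set.finite_range _
  | succ n ih =>
    refine (Set.finite_iUnion fun r => ih.image (ρ (cs.simple r))).subset ?_
    rintro b ⟨-, b', hb', r, -, -, rfl⟩
    exact Set.mem_iUnion.2 ⟨r, b', hb', rfl⟩

lemma exists_mem_smallLevel (h : IsGeomRep cs ρ) {b : S → ℝ} (hb : IsSmallRoot ρ b) :
    ∃ n, b ∈ smallLevel cs ρ n := by
  obtain ⟨m, hm, hmin⟩ : ∃ m > 0, ∀ s, ∀ β ∈ rootSet ρ, 0 < bform M (simpleRoot s) β →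
      bform M (simpleRoot s) β < 1 → m ≤ bform M (simpleRoot s) β := by
    have hmem : ∀ s, ∀ β ∈ rootSet ρ, 0 < bform M (simpleRoot s) β →
        bform M (simpleRoot s) β < 1 → bform M (simpleRoot s) β ∈
        {x : ℝ | |x| < 1 ∧ ∃ s, ∃ β ∈ rootSet ρ, x = bform M (simpleRoot s) β} ∩ Set.Ioi 0 :=
      fun s β hβ h1 h2 => ⟨⟨abs_lt.2 ⟨lt_trans (by norm_num) h1, h2⟩, s, β, hβ, rfl⟩, h1⟩
    rcases Set.eq_empty_or_nonempty
      ({x : ℝ | |x| < 1 ∧ ∃ s, ∃ β ∈ rootSet ρ, x = bform M (simpleRoot s) β} ∩ Set.Ioi 0)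
      with h0 | h0
    · refine ⟨1, one_pos, fun s β hβ h1 h2 => ?_⟩
      have h3 := hmem s β hβ h1 h2
      rw [h0] at h3
      exact absurd h3 (Set.notMem_empty _)
    · obtain ⟨m, hm, hmin⟩ := Set.exists_min_image _ id
        (h.finite_bform_values.inter_of_left (Set.Ioi 0)) h0
      exact ⟨m, hm.2, fun s β hβ h1 h2 => hmin _ (hmem s β hβ h1 h2)⟩
  obtain ⟨k, hk⟩ := exists_nat_gt (height b / m)
  rw [div_lt_iff₀ hm] at hk
  induction k generalizing b with
  | zero =>
    have := h.height_pos hb.1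
    simp at hk
    linarith
  | succ k ih =>
    by_cases hs : ∃ s, b = simpleRoot s
    · obtain ⟨s, rfl⟩ := hs
      exact ⟨0, s, rfl⟩
    · push Not at hs
      obtain ⟨r, hr⟩ := h.exists_bform_pos hb.1
      have hr1 := h.bform_simpleRoot_lt_one hb (hs r)
      have hrm := hmin r b hb.1.2 hr hr1
      obtain ⟨n, hn⟩ := ih (h.isSmallRoot_simple_apply hb (hs r) hr) (by
        rw [h.simple_apply, map_sub, map_smul, height_simpleRoot, smul_eq_mul]
        push_cast at hk
        linarith)
      have h1 : bform M (simpleRoot r) (ρ (cs.simple r) b) = -bform M (simpleRoot r) b := by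
        rw [h.simple_apply, bform_sub_right, bform_smul_right, bform_simpleRoot_self]
        ring
      exact ⟨n + 1, hb, _, hn, r, by linarith, by linarith, (h.simple_apply_simple_apply r b).symm⟩

/-- The possible states of small roots. -/
lemma finite_rootState (h : IsGeomRep cs ρ) :
    (rootState M '' {b | IsSmallRoot ρ b}).Finite := by
  have hV := h.finite_bform_values.union (Set.toFinite {(-1 : ℝ), 1})
  refine (Set.Finite.pi' fun _ : S => hV).subset ?_
  rintro _ ⟨b, hb, rfl⟩ s
  by_cases h1 : bform M (simpleRoot s) b ≤ -1
  · exact Or.inr (Or.inl (max_eq_right h1))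
  · push Not at h1
    have h2 : rootState M b s = bform M (simpleRoot s) b := max_eq_left h1.le
    rw [h2]
    by_cases hbs : b = simpleRoot s
    · rw [hbs, bform_simpleRoot_self]
      exact Or.inr (Or.inr rfl)
    · exact Or.inl ⟨abs_lt.2 ⟨h1, h.bform_simpleRoot_lt_one hb hbs⟩, s, b, hb.1.2, rfl⟩

lemma exists_finset_rootState (h : IsGeomRep cs ρ) {n : ℕ} {b : S → ℝ}
    (hb : b ∈ smallLevel cs ρ n) :
    ∃ F : Finset (S → ℝ), F.card = n + 1 ∧
      ∀ σ ∈ F, ∃ x, IsSmallRoot ρ x ∧ (x = b ∨ IsRaise M x b) ∧ σ = rootState M x := by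
  classical
  induction n generalizing b with
  | zero =>
    exact ⟨{rootState M b}, rfl, fun σ hσ =>
      ⟨b, h.isSmallRoot_of_mem_smallLevel hb, Or.inl rfl, Finset.mem_singleton.1 hσ⟩⟩
  | succ n ih =>
    obtain ⟨hbs, b', hb', r, h1, h2, rfl⟩ := hb
    have hup := h.isRaise_simple_apply h1 h2
    obtain ⟨F, hF, hFx⟩ := ih hb'
    have hFx' : ∀ σ ∈ F, ∃ x, IsSmallRoot ρ x ∧ IsRaise M x (ρ (cs.simple r) b') ∧
        σ = rootState M x := by
      intro σ hσ
      obtain ⟨x, hx, hxb, rfl⟩ := hFx σ hσ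
      rcases hxb with rfl | hxb
      · exact ⟨x, hx, hup, rfl⟩
      · exact ⟨x, hx, hxb.trans hup, rfl⟩
    refine ⟨insert (rootState M (ρ (cs.simple r) b')) F, ?_, fun σ hσ => ?_⟩
    · rw [Finset.card_insert_of_notMem, hF]
      intro hmem
      obtain ⟨x, hx, hxb, hσ⟩ := hFx' _ hmem
      exact h.rootState_ne_of_isRaise hx.1 hbs hxb hσ.symm
    · rcases Finset.mem_insert.1 hσ with rfl | hσ
      · exact ⟨_, hbs, Or.inl rfl, rfl⟩
      · obtain ⟨x, hx, hxb, rfl⟩ := hFx' σ hσ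
        exact ⟨x, hx, Or.inr hxb, rfl⟩

/-- The set of small roots is finite. -/
lemma finite_isSmallRoot (h : IsGeomRep cs ρ) : {b | IsSmallRoot ρ b}.Finite := by
  have hT := h.finite_rootState
  refine (Set.Finite.biUnion (Set.finite_Iio hT.toFinset.card)
    fun n _ => h.finite_smallLevel n).subset fun b hb => ?_
  obtain ⟨n, hn⟩ := h.exists_mem_smallLevel hb
  refine Set.mem_biUnion ?_ hn
  obtain ⟨F, hF, hFx⟩ := h.exists_finset_rootState hn
  have : F ⊆ hT.toFinset := fun σ hσ => by
    obtain ⟨x, hx, -, rfl⟩ := hFx σ hσ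
    exact hT.mem_toFinset.2 ⟨x, hx, rfl⟩
  have := Finset.card_le_card this
  exact Set.mem_Iio.2 (by omega)

/-! ### Low elements -/

lemma isLow_simple (h : IsGeomRep cs ρ) (s : S) : IsLow cs ρ (cs.simple s) := by
  intro b hb
  have h1 := h.mem_invSet_iff.1 (h.nOne_subset_invSet _ hb)
  rw [cs.inv_simple] at h1
  rw [h.eq_simpleRoot_of_height_neg h1.1 h1.2]
  exact h.simpleRoot_isSmallRoot s

lemma finite_isLow (h : IsGeomRep cs ρ) : {w | IsLow cs ρ w}.Finite := by
  refine Set.Finite.of_finite_image (f := nOne cs ρ) (h.finite_isSmallRoot.finite_subsets.subset ?_)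
    fun u _ v _ huv => h.eq_of_nOne_eq huv
  rintro _ ⟨w, hw, rfl⟩
  exact hw

end IsGeomRep

/-! ### Joins -/

/-- A set of roots containing every root which is a positive combination of two of its members. -/
def IsConeClosed (ρ : W →* ((S → ℝ) ≃ₗ[ℝ] (S → ℝ))) (X : Set (S → ℝ)) : Prop :=
  ∀ γ₁ ∈ X, ∀ γ₂ ∈ X, ∀ a b : ℝ, 0 < a → 0 < b → a • γ₁ + b • γ₂ ∈ rootSet ρ →
    a • γ₁ + b • γ₂ ∈ X

/-- `j` is an upper bound of `u` and `v` below `w`, and its inversions are generated by those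
of `u` and `v`. -/
structure IsGeneratedJoin (ρ : W →* ((S → ℝ) ≃ₗ[ℝ] (S → ℝ))) (u v w j : W) : Prop where
  le : invSet ρ j ⊆ invSet ρ w
  left : invSet ρ u ⊆ invSet ρ j
  right : invSet ρ v ⊆ invSet ρ j
  generated : ∀ X, IsConeClosed ρ X → invSet ρ u ⊆ X → invSet ρ v ⊆ X → invSet ρ j ⊆ X

namespace IsGeomRep

lemma not_mem_invSet_simple_mul (h : IsGeomRep cs ρ) {s : S} {w : W}
    (hs : simpleRoot s ∈ invSet ρ w) : simpleRoot s ∉ invSet ρ (cs.simple s * w) := by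
  have := h.length_simple_mul_of_mem hs
  rw [h.mem_invSet_simple_iff, cs.simple_mul_simple_cancel_left]
  omega

lemma mem_invSet_simple_mul (h : IsGeomRep cs ρ) {s : S} {w : W}
    (hs : simpleRoot s ∉ invSet ρ w) : simpleRoot s ∈ invSet ρ (cs.simple s * w) := by
  rw [h.mem_invSet_simple_iff] at hs
  rw [h.mem_invSet_simple_iff, cs.simple_mul_simple_cancel_left]
  have := cs.length_simple_mul w s
  omega

lemma simple_apply_mem_of_mem_invSet_simple_mul (h : IsGeomRep cs ρ) {s : S} {w : W}
    (hs : simpleRoot s ∈ invSet ρ w) {b : S → ℝ} (hb : b ∈ invSet ρ (cs.simple s * w)) :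
    ρ (cs.simple s) b ∈ invSet ρ w := by
  have hbs : b ≠ simpleRoot s := fun hbs => h.not_mem_invSet_simple_mul hs (hbs ▸ hb)
  have := (h.simple_apply_mem_invSet_iff hb.1 hbs (cs.simple s * w)).2 hb
  rwa [cs.simple_mul_simple_cancel_left] at this

lemma isGeneratedJoin_of_common_descent (h : IsGeomRep cs ρ) {u v w j : W} {s : S}
    (hu : simpleRoot s ∈ invSet ρ u) (hv : simpleRoot s ∈ invSet ρ v)
    (hw : simpleRoot s ∈ invSet ρ w)
    (hj : IsGeneratedJoin ρ (cs.simple s * u) (cs.simple s * v) (cs.simple s * w) j) :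
    IsGeneratedJoin ρ u v w (cs.simple s * j) := by
  have hsj : simpleRoot s ∉ invSet ρ j := fun hsj => h.not_mem_invSet_simple_mul hw (hj.le hsj)
  have hsj' := h.mem_invSet_simple_mul hsj
  refine ⟨?_, ?_, ?_, fun X hX huX hvX => ?_⟩
  · rw [h.invSet_subset_iff_simple_mul hsj' hw, cs.simple_mul_simple_cancel_left]
    exact hj.le
  · rw [h.invSet_subset_iff_simple_mul hu hsj', cs.simple_mul_simple_cancel_left]
    exact hj.left
  · rw [h.invSet_subset_iff_simple_mul hv hsj', cs.simple_mul_simple_cancel_left]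
    exact hj.right
  · have h1 := hj.generated {γ | ρ (cs.simple s) γ ∈ X} (by
      intro γ₁ hγ₁ γ₂ hγ₂ a b ha hb hr
      have h2 := apply_mem_rootSet hr (cs.simple s)
      simp only [Set.mem_ofPred_eq, map_add, map_smul] at h2 ⊢
      exact hX _ hγ₁ _ hγ₂ a b ha hb h2)
      (fun γ hγ => huX (h.simple_apply_mem_of_mem_invSet_simple_mul hu hγ))
      (fun γ hγ => hvX (h.simple_apply_mem_of_mem_invSet_simple_mul hv hγ))
    intro γ hγ
    by_cases hγs : γ = simpleRoot s
    · exact huX (hγs ▸ hu)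
    · have h3 := (h.simple_apply_mem_invSet_iff hγ.1 hγs _).2 hγ
      rw [cs.simple_mul_simple_cancel_left] at h3
      have h4 := h1 h3
      rwa [Set.mem_ofPred_eq, h.simple_apply_simple_apply] at h4

lemma length_le_of_invSet_subset (h : IsGeomRep cs ρ) {u w : W}
    (huw : invSet ρ u ⊆ invSet ρ w) : cs.length u ≤ cs.length w := by
  rw [← h.ncard_invSet, ← h.ncard_invSet]
  exact Set.ncard_le_ncard huw (h.finite_invSet w)

/-- If two simple roots are inversions of `w` then some element of the corresponding dihedral
parabolic subgroup lies below `w` and has both of them as inversions. -/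
lemma exists_rank_two_le (h : IsGeomRep cs ρ) {s r : S} {w : W} (hs : simpleRoot s ∈ invSet ρ w)
    (hr : simpleRoot r ∈ invSet ρ w) (hsr : s ≠ r) :
    ∃ d : W, invSet ρ d ⊆ invSet ρ w ∧ simpleRoot s ∈ invSet ρ d ∧ simpleRoot r ∈ invSet ρ d ∧
      ∀ X, IsConeClosed ρ X → simpleRoot s ∈ X → simpleRoot r ∈ X → invSet ρ d ⊆ X := by
  have hdec : ∀ v : S → ℝ, (∀ t, t ≠ s → t ≠ r → v t = 0) →
      v = v s • simpleRoot s + v r • simpleRoot r := by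
    intro v hv
    ext t
    by_cases hts : t = s
    · subst hts
      simp [simpleRoot_self, simpleRoot_of_ne hsr]
    · by_cases htr : t = r
      · subst htr
        simp [simpleRoot_self, simpleRoot_of_ne hts]
      · simp [simpleRoot_of_ne hts, simpleRoot_of_ne htr, hv t hts htr]
  obtain ⟨d, ⟨hdw, hd⟩, hmax⟩ := (measure fun d : W => cs.length w - cs.length d).wf.has_min
    {d | invSet ρ d ⊆ invSet ρ w ∧ ∀ (v : S → ℝ) (t : S), t ≠ s → t ≠ r → ρ d v t = v t}
    ⟨1, by rw [h.invSet_one]; exact Set.empty_subset _, fun v t _ _ => by rw [rho_one_apply]⟩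
  have hdinv : ∀ (v : S → ℝ) (t : S), t ≠ s → t ≠ r → ρ d⁻¹ v t = v t := by
    intro v t hts htr
    rw [← hd (ρ d⁻¹ v) t hts htr, rho_apply_inv_apply]
  have hstep : ∀ t, (t = s ∨ t = r) → 0 ≤ height (ρ w⁻¹ (ρ d (simpleRoot t))) := by
    intro t ht
    by_contra! hneg
    have hroot := apply_mem_rootSet (simpleRoot_mem_rootSet ρ t) d
    have hpos : ρ d (simpleRoot t) ∈ posRoots ρ := by
      by_contra hnp
      have h1 : -ρ d (simpleRoot t) ∈ invSet ρ d := by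
        refine h.mem_invSet_iff.2 ⟨?_, ?_⟩
        · refine h.mem_negRoots_iff.2 ⟨hroot, h.height_neg_of_not_pos hroot fun h2 => ?_⟩
          exact hnp (h.mem_posRoots_iff.2 ⟨hroot, h2⟩)
        · rw [map_neg, rho_inv_apply_apply, map_neg, height_simpleRoot]
          norm_num
      have h2 := (h.mem_invSet_iff.1 (hdw h1)).2
      rw [map_neg, map_neg] at h2
      linarith
    have hmem : ρ d (simpleRoot t) ∈ invSet ρ w := h.mem_invSet_iff.2 ⟨hpos, hneg⟩
    have hsub : invSet ρ (d * cs.simple t) ⊆ invSet ρ w := by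
      intro γ hγ
      have h1 := (h.mem_invSet_iff.1 hγ).2
      rw [mul_inv_rev, cs.inv_simple, rho_mul_apply] at h1
      have hγr := apply_mem_rootSet hγ.1.2 d⁻¹
      by_cases h2 : height (ρ d⁻¹ γ) < 0
      · exact hdw (h.mem_invSet_iff.2 ⟨hγ.1, h2⟩)
      · have h3 := h.eq_simpleRoot_of_height_neg
          (h.mem_posRoots_iff.2 ⟨hγr, h.height_pos_of_not_neg hγr h2⟩) h1
        rwa [← h3, rho_apply_inv_apply] at hmem
    have hlt : cs.length d < cs.length (d * cs.simple t) := by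
      have h1 : invSet ρ d ⊆ invSet ρ (d * cs.simple t) := by
        intro γ hγ
        obtain ⟨h1, h2⟩ := h.mem_invSet_iff.1 hγ
        refine h.mem_invSet_iff.2 ⟨h1, ?_⟩
        rw [mul_inv_rev, cs.inv_simple, rho_mul_apply]
        have h3 : -ρ d⁻¹ γ ∈ posRoots ρ :=
          h.mem_negRoots_iff.2 ⟨apply_mem_rootSet h1.2 _, h2⟩
        have h4 : -ρ d⁻¹ γ ≠ simpleRoot t := by
          intro h4
          have h5 := h.height_pos h1
          have h6 := h.height_pos hpos
          rw [← h4, map_neg, rho_apply_inv_apply, map_neg] at h6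
          linarith
        have h5 := h.height_pos (h.simple_apply_mem_posRoots h3 h4)
        rw [map_neg, map_neg] at h5
        linarith
      have h2 := h.length_le_of_invSet_subset h1
      have h3 := cs.length_mul_simple d t
      omega
    have hle := h.length_le_of_invSet_subset hsub
    refine hmax (d * cs.simple t) ⟨hsub, fun v x hxs hxr => ?_⟩ ?_
    · rw [rho_mul_apply, hd _ x hxs hxr, h.simple_apply_apply_of_ne]
      rcases ht with rfl | rfl <;> assumption
    · change cs.length w - cs.length (d * cs.simple t) < cs.length w - cs.length d
      omega
  have hmem : ∀ t, (t = s ∨ t = r) → simpleRoot t ∈ invSet ρ w → simpleRoot t ∈ invSet ρ d := by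
    intro t ht htw
    obtain ⟨h1, h2⟩ := h.mem_invSet_iff.1 htw
    refine h.mem_invSet_iff.2 ⟨h1, ?_⟩
    by_contra hnn
    have hroot := apply_mem_rootSet (simpleRoot_mem_rootSet ρ t) d⁻¹
    have hpos := h.mem_posRoots_iff.2 ⟨hroot, h.height_pos_of_not_neg hroot hnn⟩
    have h3 := hdec (ρ d⁻¹ (simpleRoot t)) fun x hxs hxr => by
      rw [hdinv _ x hxs hxr, simpleRoot_of_ne]
      rcases ht with rfl | rfl <;> assumption
    have h4 : simpleRoot t = ρ d (ρ d⁻¹ (simpleRoot t)) := (rho_apply_inv_apply ρ d _).symm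
    rw [h4, h3] at h2
    simp only [map_add, map_smul, smul_eq_mul] at h2
    have h5 := mul_nonneg (h.nonneg_of_mem_posRoots hpos s) (hstep s (Or.inl rfl))
    have h6 := mul_nonneg (h.nonneg_of_mem_posRoots hpos r) (hstep r (Or.inr rfl))
    linarith
  refine ⟨d, hdw, hmem s (Or.inl rfl) hs, hmem r (Or.inr rfl) hr, fun X hX hsX hrX γ hγ => ?_⟩
  obtain ⟨h1, h2⟩ := h.mem_invSet_iff.1 hγ
  have h3 : -ρ d⁻¹ γ ∈ posRoots ρ := h.mem_negRoots_iff.2 ⟨apply_mem_rootSet h1.2 _, h2⟩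
  have h4 := hdec γ fun x hxs hxr => by
    have h5 := h.nonneg_of_mem_posRoots h3 x
    have h6 := h.nonneg_of_mem_posRoots h1 x
    rw [Pi.neg_apply, hdinv _ x hxs hxr] at h5
    linarith
  have hγs := h.nonneg_of_mem_posRoots h1 s
  have hγr := h.nonneg_of_mem_posRoots h1 r
  rcases hγs.eq_or_lt with h5 | h5
  · rw [← h5, zero_smul, zero_add] at h4
    rwa [h.eq_of_eq_smul_of_pos (h.simpleRoot_mem_posRoots r) h1 h4]
  rcases hγr.eq_or_lt with h6 | h6
  · rw [← h6, zero_smul, add_zero] at h4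
    rwa [h.eq_of_eq_smul_of_pos (h.simpleRoot_mem_posRoots s) h1 h4]
  rw [h4]
  exact hX _ hsX _ hrX _ _ h5 h6 (h4 ▸ h1.2)

/-- Two elements with a common upper bound have an upper bound whose inversions are generated by
theirs. -/
lemma exists_isGeneratedJoin (h : IsGeomRep cs ρ) {u v w : W} (hu : invSet ρ u ⊆ invSet ρ w)
    (hv : invSet ρ v ⊆ invSet ρ w) : ∃ j, IsGeneratedJoin ρ u v w j := by
  induction hn : cs.length w using Nat.strong_induction_on generalizing u v w with
  | _ n ih =>
  have hcommon : ∀ u v s, invSet ρ u ⊆ invSet ρ w → invSet ρ v ⊆ invSet ρ w →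
      simpleRoot s ∈ invSet ρ u → simpleRoot s ∈ invSet ρ v →
      ∃ j, IsGeneratedJoin ρ u v w j := by
    intro u v s hu hv hsu hsv
    obtain ⟨j, hj⟩ := ih (cs.length (cs.simple s * w))
      (by have := h.length_simple_mul_of_mem (hu hsu); omega)
      ((h.invSet_subset_iff_simple_mul hsu (hu hsu)).1 hu)
      ((h.invSet_subset_iff_simple_mul hsv (hv hsv)).1 hv) rfl
    exact ⟨_, h.isGeneratedJoin_of_common_descent hsu hsv (hu hsu) hj⟩
  by_cases hu1 : u = 1
  · subst hu1
    exact ⟨v, hv, by rw [h.invSet_one]; exact Set.empty_subset _, subset_rfl,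
      fun X _ _ hX => hX⟩
  by_cases hv1 : v = 1
  · subst hv1
    exact ⟨u, hu, subset_rfl, by rw [h.invSet_one]; exact Set.empty_subset _,
      fun X _ hX _ => hX⟩
  obtain ⟨s, hs⟩ := h.exists_simpleRoot_mem_invSet hu1
  obtain ⟨r, hr⟩ := h.exists_simpleRoot_mem_invSet hv1
  by_cases hsr : s = r
  · subst hsr
    exact hcommon u v s hu hv hs hr
  obtain ⟨d, hdw, hsd, hrd, hdX⟩ := h.exists_rank_two_le (hu hs) (hv hr) hsr
  obtain ⟨j₁, hj₁⟩ := hcommon d v r hdw hv hrd hr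
  obtain ⟨j, hj⟩ := hcommon u j₁ s hu hj₁.le hs (hj₁.left hsd)
  exact ⟨j, hj.le, hj.left, hj₁.right.trans hj.right, fun X hX huX hvX =>
    hj.generated X hX huX (hj₁.generated X hX (hdX X hX (huX hs) (hvX hr)) hvX)⟩

lemma isConeClosed_invSet (h : IsGeomRep cs ρ) (w : W) : IsConeClosed ρ (invSet ρ w) := by
  intro γ₁ hγ₁ γ₂ hγ₂ a b ha hb hr
  obtain ⟨h1, h2⟩ := h.mem_invSet_iff.1 hγ₁
  obtain ⟨h3, h4⟩ := h.mem_invSet_iff.1 hγ₂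
  refine h.mem_invSet_iff.2 ⟨h.mem_posRoots_iff.2 ⟨hr, ?_⟩, ?_⟩
  · rw [map_add, map_smul, map_smul, smul_eq_mul, smul_eq_mul]
    have := mul_pos ha (h.height_pos h1)
    have := mul_pos hb (h.height_pos h3)
    linarith
  · simp only [map_add, map_smul, smul_eq_mul]
    have := mul_neg_of_pos_of_neg ha h2
    have := mul_neg_of_pos_of_neg hb h4
    linarith

lemma mem_nOne_of_subset (h : IsGeomRep cs ρ) {u w : W} (huw : invSet ρ u ⊆ invSet ρ w)
    {b : S → ℝ} (hb : b ∈ nOne cs ρ w) (hbu : b ∈ invSet ρ u) : b ∈ nOne cs ρ u :=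
  h.mem_nOne_iff.2 ⟨hbu, fun η hη hη' => (h.mem_nOne_iff.1 hb).2 η (huw hη) (huw hη')⟩

/-- Low elements are closed under join. -/
lemma isLow_of_isJoin (h : IsGeomRep cs ρ) {u v j : W} (hu : IsLow cs ρ u) (hv : IsLow cs ρ v)
    (hj : IsJoin cs u v j) : IsLow cs ρ j := by
  intro β hβ
  obtain ⟨huj, hvj, hmin⟩ := hj
  rw [h.weakLE_iff] at huj hvj
  by_cases hβu : β ∈ invSet ρ u
  · exact hu β (h.mem_nOne_of_subset huj hβ hβu)
  by_cases hβv : β ∈ invSet ρ v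
  · exact hv β (h.mem_nOne_of_subset hvj hβ hβv)
  obtain ⟨k, hk⟩ := h.exists_isGeneratedJoin huj hvj
  have hjk := h.weakLE_iff.1 (hmin k (h.weakLE_iff.2 hk.left) (h.weakLE_iff.2 hk.right))
  have hX : IsConeClosed ρ (invSet ρ j \ {β}) := by
    intro γ₁ hγ₁ γ₂ hγ₂ a b ha hb hr
    refine ⟨h.isConeClosed_invSet j _ hγ₁.1 _ hγ₂.1 a b ha hb hr, fun heq => ?_⟩
    exact h.ne_smul_add_smul_of_mem_nOne hβ hγ₁.1 hγ₂.1 hγ₁.2 hγ₂.2 ha hb heq.symm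
  have h1 := hk.generated _ hX (fun γ hγ => ⟨huj hγ, fun h2 => hβu (h2 ▸ hγ)⟩)
    (fun γ hγ => ⟨hvj hγ, fun h2 => hβv (h2 ▸ hγ)⟩)
  exact absurd rfl (h1 (hjk (h.nOne_subset_invSet j hβ))).2

end IsGeomRep

/-! ### Length two intervals in the Bruhat graph -/

namespace IsGeomRep

/-- A form of the lifting property. -/
lemma reflOf_mul_eq_mul_simple (h : IsGeomRep cs ρ) {y : W} {a : S → ℝ} (ha : a ∈ rootSet ρ)
    {r : S} (h1 : cs.length (reflOf M ρ a * y) + 1 = cs.length y)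
    (h2 : cs.length (y * cs.simple r) < cs.length y)
    (h3 : cs.length (reflOf M ρ a * y) < cs.length (reflOf M ρ a * y * cs.simple r)) :
    reflOf M ρ a * y = y * cs.simple r := by
  wlog hpos : 0 < height a generalizing a
  · have := this (h.neg_mem_rootSet ha) (by rwa [h.reflOf_neg ha]) (by rwa [h.reflOf_neg ha]) (by
      rw [map_neg]
      linarith [h.height_neg_of_not_pos ha hpos])
    rwa [h.reflOf_neg ha] at this
  have hap := h.mem_posRoots_iff.2 ⟨ha, hpos⟩
  have h4 := (h.mem_invSet_iff.1 ((h.mem_invSet_iff_length_lt (u := y) hap).2 (by omega))).2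
  have h5 : 0 < height (ρ (y * cs.simple r)⁻¹ a) := by
    refine h.height_pos_of_not_neg (apply_mem_rootSet ha _) fun h5 => ?_
    have h6 := (h.mem_invSet_iff_length_lt hap).1 (h.mem_invSet_iff.2 ⟨hap, h5⟩)
    rw [← mul_assoc] at h6
    omega
  rw [mul_inv_rev, cs.inv_simple, rho_mul_apply] at h5
  have h6 : -ρ y⁻¹ a ∈ posRoots ρ := h.mem_negRoots_iff.2 ⟨apply_mem_rootSet ha _, h4⟩
  have h7 := h.eq_simpleRoot_of_height_neg h6 (s := r) (by
    rw [map_neg, map_neg]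
    linarith)
  have h8 : a = ρ y (-simpleRoot r) := by
    rw [← h7, neg_neg, rho_apply_inv_apply]
  have h9 := simpleRoot_mem_rootSet ρ r
  rw [h8, h.reflOf_conj (h.neg_mem_rootSet h9), h.reflOf_neg h9, h.reflOf_simpleRoot]
  group

lemma reflOf_reflOf_apply (h : IsGeomRep cs ρ) {a b : S → ℝ} (ha : a ∈ rootSet ρ)
    (hb : b ∈ rootSet ρ) :
    reflOf M ρ (ρ (reflOf M ρ b) a) = reflOf M ρ b * reflOf M ρ a * reflOf M ρ b := by
  rw [h.reflOf_conj ha, h.inv_reflOf hb]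

/-- If `w` covers `σ_a w` which covers `σ_b σ_a w` in Bruhat order, then there is another chain of
this form with the same end points. -/
lemma exists_other_reflOf (h : IsGeomRep cs ρ) (U : Submodule ℝ (S → ℝ)) {w : W} {a b : S → ℝ}
    (ha : a ∈ rootSet ρ) (hb : b ∈ rootSet ρ) (haU : a ∈ U) (hbU : b ∈ U)
    (h1 : cs.length (reflOf M ρ a * w) + 1 = cs.length w)
    (h2 : cs.length (reflOf M ρ b * (reflOf M ρ a * w)) + 1 = cs.length (reflOf M ρ a * w)) :
    ∃ c ∈ rootSet ρ, ∃ d ∈ rootSet ρ, c ∈ U ∧ d ∈ U ∧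
      reflOf M ρ d * reflOf M ρ c = reflOf M ρ b * reflOf M ρ a ∧
      reflOf M ρ c ≠ reflOf M ρ a ∧ cs.length (reflOf M ρ c * w) + 1 = cs.length w := by
  have hU : ∀ {x y : S → ℝ}, x ∈ rootSet ρ → x ∈ U → y ∈ U → ρ (reflOf M ρ x) y ∈ U := by
    intro x y hx hxU hyU
    rw [h.reflOf_apply hx]
    exact U.sub_mem hyU (U.smul_mem _ hxU)
  induction hn : cs.length w using Nat.strong_induction_on generalizing w a b with
  | _ n ih =>
  obtain ⟨r, hr⟩ := cs.exists_rightDescent_of_ne_one (w := w) (by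
    rintro rfl
    simp at h1)
  unfold CoxeterSystem.IsRightDescent at hr
  have hw' := cs.length_mul_simple w r
  have hu' := cs.length_mul_simple (reflOf M ρ a * w) r
  have hz' := cs.length_mul_simple (reflOf M ρ b * (reflOf M ρ a * w)) r
  have hA := h.reflOf_mul_cancel_left ha
  have hB := h.reflOf_mul_cancel_left hb
  by_cases hu : cs.length (reflOf M ρ a * w * cs.simple r) < cs.length (reflOf M ρ a * w)
  · by_cases hz : cs.length (reflOf M ρ b * (reflOf M ρ a * w) * cs.simple r) <
        cs.length (reflOf M ρ b * (reflOf M ρ a * w))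
    · obtain ⟨c, hc, d, hd, hcU, hdU, hdc, hca, hcw⟩ := ih (cs.length (w * cs.simple r)) (by omega)
        ha hb haU hbU (by rw [← mul_assoc]; omega) (by
          simp only [← mul_assoc] at *
          omega) rfl
      by_cases hx : cs.length (reflOf M ρ c * (w * cs.simple r)) < cs.length (reflOf M ρ c * w)
      · refine ⟨c, hc, d, hd, hcU, hdU, hdc, hca, ?_⟩
        have := cs.length_mul_simple (reflOf M ρ c * w) r
        simp only [← mul_assoc] at *
        omega
      · have hcx := cs.length_mul_simple (reflOf M ρ c * w) r
        have e1 : reflOf M ρ d * (reflOf M ρ c * (w * cs.simple r)) =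
            reflOf M ρ b * (reflOf M ρ a * w) * cs.simple r := by
          rw [← mul_assoc, hdc]
          simp only [mul_assoc]
        have key := h.reflOf_mul_eq_mul_simple hd (y := reflOf M ρ c * (w * cs.simple r)) (r := r)
          (by rw [e1, ← mul_assoc]; simp only [← mul_assoc] at *; omega)
          (by simp only [← mul_assoc] at *; simp only [cs.simple_mul_simple_cancel_right] at *; omega)
          (by rw [e1, cs.simple_mul_simple_cancel_right]; exact hz)
        have hC := h.reflOf_mul_cancel_left hc
        have e2 : reflOf M ρ (ρ (reflOf M ρ c) d) * w = w * cs.simple r := by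
          rw [h.reflOf_reflOf_apply hd hc]
          have e3 : reflOf M ρ d * (reflOf M ρ c * w) = reflOf M ρ c * (w * cs.simple r) := by
            apply mul_right_cancel (b := cs.simple r)
            rw [← key]
            simp only [mul_assoc]
          rw [mul_assoc, mul_assoc, e3, hC]
        refine ⟨ρ (reflOf M ρ c) d, apply_mem_rootSet hd _, c, hc, hU hc hcU hdU, hcU, ?_, ?_, ?_⟩
        · rw [h.reflOf_reflOf_apply hd hc, mul_assoc, hC, hdc]
        · intro heq
          rw [heq] at e2
          rw [e2, cs.simple_mul_simple_cancel_right] at hu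
          omega
        · rw [e2]
          omega
    · have key := h.reflOf_mul_eq_mul_simple hb h2 hu (by omega)
      have e2 : reflOf M ρ (ρ (reflOf M ρ a) b) * w = w * cs.simple r := by
        rw [h.reflOf_reflOf_apply hb ha, mul_assoc, mul_assoc, key, mul_assoc, hA]
      refine ⟨ρ (reflOf M ρ a) b, apply_mem_rootSet hb _, a, ha, hU ha haU hbU, haU, ?_, ?_, ?_⟩
      · rw [h.reflOf_reflOf_apply hb ha, mul_assoc, hA]
      · intro heq
        rw [heq] at e2
        rw [e2, cs.simple_mul_simple_cancel_right] at hu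
        omega
      · rw [e2]
        omega
  · have key := h.reflOf_mul_eq_mul_simple ha h1 hr (by omega)
    have e1 : reflOf M ρ (ρ (reflOf M ρ b) a) * reflOf M ρ b = reflOf M ρ b * reflOf M ρ a := by
      rw [h.reflOf_reflOf_apply ha hb, mul_assoc, h.reflOf_mul_self hb, mul_one]
    have e2 : reflOf M ρ b * (reflOf M ρ a * w) * cs.simple r = reflOf M ρ b * w := by
      rw [key, mul_assoc, cs.simple_mul_simple_cancel_right]
    by_cases hz : cs.length (reflOf M ρ b * (reflOf M ρ a * w) * cs.simple r) <
        cs.length (reflOf M ρ b * (reflOf M ρ a * w))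
    · obtain ⟨c, hc, d, hd, hcU, hdU, hdc, hcb, hcw⟩ := ih (cs.length (w * cs.simple r)) (by omega)
        (w := w * cs.simple r) (a := b) (b := ρ (reflOf M ρ b) a) hb (apply_mem_rootSet ha _) hbU
        (hU hb hbU haU) (by rw [← key]; omega) (by
          rw [← mul_assoc, e1, mul_assoc, ← key, hA, ← e2]
          omega) rfl
      rw [e1] at hdc
      have hcw' : reflOf M ρ c * w = reflOf M ρ c * (w * cs.simple r) * cs.simple r := by
        rw [mul_assoc, cs.simple_mul_simple_cancel_right]
      have hcx := cs.length_mul_simple (reflOf M ρ c * (w * cs.simple r)) r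
      rw [← hcw'] at hcx
      by_cases hx : cs.length (reflOf M ρ c * (w * cs.simple r)) < cs.length (reflOf M ρ c * w)
      · refine ⟨c, hc, d, hd, hcU, hdU, hdc, fun heq => ?_, by omega⟩
        rw [heq, ← key, hA] at hcw
        omega
      · have e3 : reflOf M ρ d * (reflOf M ρ c * (w * cs.simple r)) = reflOf M ρ b * w := by
          rw [← mul_assoc, hdc, mul_assoc, ← key, hA]
        have e4 : reflOf M ρ b * w * cs.simple r = reflOf M ρ b * (reflOf M ρ a * w) := by
          rw [key, mul_assoc]
        have key' := h.reflOf_mul_eq_mul_simple hd (y := reflOf M ρ c * (w * cs.simple r)) (r := r)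
          (by rw [e3]; rw [e2] at hz hz'; have := congrArg cs.length key; omega)
          (by rw [← hcw']; omega)
          (by rw [e3, e4]; rw [e2] at hz; exact hz)
        rw [e3, ← hcw'] at key'
        exact absurd (mul_right_cancel key').symm hcb
    · refine ⟨b, hb, ρ (reflOf M ρ b) a, apply_mem_rootSet ha _, hbU, hU hb hbU haU, e1,
        fun heq => ?_, ?_⟩
      · rw [heq, hA] at h2
        omega
      · rw [← e2]
        omega

end IsGeomRep

/-! ### Canonical pairs of roots -/

/-- No root is a combination of `a` and `b` with coefficients of strictly opposite signs. -/
def IsCanonicalPair (ρ : W →* ((S → ℝ) ≃ₗ[ℝ] (S → ℝ))) (a b : S → ℝ) : Prop :=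
  ∀ x y : ℝ, x • a + y • b ∈ rootSet ρ → 0 ≤ x * y

/-- The sum of the coordinates other than `s`. -/
def offHeight (s : S) : (S → ℝ) →ₗ[ℝ] ℝ := ∑ t ∈ Finset.univ.erase s, LinearMap.proj t

lemma offHeight_apply (s : S) (v : S → ℝ) : offHeight s v = ∑ t ∈ Finset.univ.erase s, v t := by
  simp [offHeight, LinearMap.sum_apply]

lemma offHeight_simpleRoot (s : S) : offHeight s (simpleRoot s) = 0 := by
  rw [offHeight_apply]
  exact Finset.sum_eq_zero fun t ht => simpleRoot_of_ne (Finset.ne_of_mem_erase ht)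

namespace IsGeomRep

lemma offHeight_pos (h : IsGeomRep cs ρ) {s : S} {b : S → ℝ} (hb : b ∈ posRoots ρ)
    (hbs : b ≠ simpleRoot s) : 0 < offHeight s b := by
  obtain ⟨t, hts, ht⟩ := h.exists_ne_pos hb hbs
  rw [offHeight_apply]
  exact Finset.sum_pos' (fun x _ => h.nonneg_of_mem_posRoots hb x)
    ⟨t, Finset.mem_erase.2 ⟨hts, Finset.mem_univ t⟩, ht⟩

lemma offHeight_nonneg (h : IsGeomRep cs ρ) {b : S → ℝ} (s : S) (hb : b ∈ posRoots ρ) :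
    0 ≤ offHeight s b := by
  rw [offHeight_apply]
  exact Finset.sum_nonneg fun x _ => h.nonneg_of_mem_posRoots hb x

lemma neg_mem_posRoots (h : IsGeomRep cs ρ) {b : S → ℝ} (hb : b ∈ rootSet ρ)
    (hn : b ∉ posRoots ρ) : -b ∈ posRoots ρ :=
  h.mem_negRoots_iff.2 ⟨hb, h.height_neg_of_not_pos hb fun hp => hn (h.mem_posRoots_iff.2 ⟨hb, hp⟩)⟩

lemma mem_posRoots_of_offHeight_pos (h : IsGeomRep cs ρ) {s : S} {b : S → ℝ}
    (hb : b ∈ rootSet ρ) (hs : 0 < offHeight s b) : b ∈ posRoots ρ := by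
  by_contra hn
  have := h.offHeight_nonneg s (h.neg_mem_posRoots hb hn)
  rw [map_neg] at this
  linarith

lemma neg_mem_posRoots_of_offHeight_neg (h : IsGeomRep cs ρ) {s : S} {b : S → ℝ}
    (hb : b ∈ rootSet ρ) (hs : offHeight s b < 0) : -b ∈ posRoots ρ :=
  h.mem_posRoots_of_offHeight_pos (s := s) (h.neg_mem_rootSet hb) (by rw [map_neg]; linarith)

lemma eq_of_offHeight_eq_zero (h : IsGeomRep cs ρ) {s : S} {b : S → ℝ}
    (hb : b ∈ rootSet ρ) (hs : offHeight s b = 0) : b = simpleRoot s ∨ b = -simpleRoot s := by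
  by_cases hp : b ∈ posRoots ρ
  · refine Or.inl ?_
    by_contra hne
    exact (h.offHeight_pos hp hne).ne' hs
  · refine Or.inr (neg_eq_iff_eq_neg.1 ?_)
    by_contra hne
    have := h.offHeight_pos (h.neg_mem_posRoots hb hp) hne
    rw [map_neg] at this
    linarith

lemma bform_nonpos_of_isCanonicalPair (h : IsGeomRep cs ρ) {a b : S → ℝ} (ha : a ∈ rootSet ρ)
    (hb : b ∈ rootSet ρ) (hab : IsCanonicalPair ρ a b) : bform M a b ≤ 0 := by
  have h1 := h.sub_smul_mem_rootSet ha hb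
  rw [show b - (2 * bform M a b) • a = (-(2 * bform M a b)) • a + (1 : ℝ) • b by module] at h1
  have := hab _ _ h1
  linarith

lemma half_le_of_isCanonicalPair (h : IsGeomRep cs ρ) {a b : S → ℝ} (ha : a ∈ rootSet ρ)
    (hb : b ∈ rootSet ρ) (hab : IsCanonicalPair ρ a b) {C : ℝ} (hC : bform M a b = -C)
    (hC0 : 0 < C) : 1 / 2 ≤ C ∧ (C = 1 / 2 ∨ 1 / 2 ≤ C ^ 2) := by
  have hba := (bform_comm (M := M) b a).trans hC
  have haa := h.bform_self ha
  have hbb := h.bform_self hb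
  have h1 := h.sub_smul_mem_rootSet ha hb
  have h2 := h.sub_smul_mem_rootSet hb h1
  have h3 := h.sub_smul_mem_rootSet ha h2
  simp only [bform_sub_right, bform_smul_right, hC, hba, haa, hbb] at h2 h3
  have e2 := hab (2 * C) (4 * C ^ 2 - 1) (by convert h2 using 1; module)
  have e3 := hab (2 * C * (4 * C ^ 2 - 2)) (4 * C ^ 2 - 1) (by convert h3 using 1; module)
  have e4 : 0 ≤ 4 * C ^ 2 - 1 := nonneg_of_mul_nonneg_right e2 (by linarith)
  have e5 : 1 / 2 ≤ C := by nlinarith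
  refine ⟨e5, ?_⟩
  rcases e5.eq_or_lt with e6 | e6
  · exact Or.inl e6.symm
  · refine Or.inr ?_
    have e7 : 0 < 4 * C ^ 2 - 1 := by nlinarith
    have e8 := nonneg_of_mul_nonneg_left e3 e7
    have e9 : 0 ≤ 4 * C ^ 2 - 2 := nonneg_of_mul_nonneg_right e8 (by linarith)
    linarith

/-- The choice of an extremal root among those separated from the fundamental chamber by `f`. -/
lemma exists_extremal (h : IsGeomRep cs ρ) {s : S} {f : (S → ℝ) →ₗ[ℝ] ℝ}
    {U : Submodule ℝ (S → ℝ)} (hfin : {b ∈ posRoots ρ | b ∈ U ∧ f b < 0}.Finite)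
    (hne : {b ∈ posRoots ρ | b ∈ U ∧ f b < 0}.Nonempty) (hfs : f (simpleRoot s) = 0)
    (hsU : simpleRoot s ∈ U) :
    ∃ c ∈ rootSet ρ, c ∈ U ∧ 0 < f c ∧ offHeight s c < 0 ∧ -c ∈ posRoots ρ ∧
      IsCanonicalPair ρ (simpleRoot s) c ∧ ∃ τ : ℝ, 0 < τ ∧ f c + τ * offHeight s c = 0 ∧
        ∀ b ∈ posRoots ρ, b ∈ U → f b < 0 → f b + τ * offHeight s b ≤ 0 := by
  have hoff : ∀ b ∈ posRoots ρ, f b < 0 → 0 < offHeight s b := by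
    refine fun b hb hfb => h.offHeight_pos hb ?_
    rintro rfl
    linarith
  obtain ⟨b₁, hb₁, hmin⟩ := Set.exists_min_image _ (fun b => -f b / offHeight s b) hfin hne
  have hb₁' := hoff b₁ hb₁.1 hb₁.2.2
  set τ := -f b₁ / offHeight s b₁ with hτ
  have hτ0 : 0 < τ := div_pos (neg_pos.2 hb₁.2.2) hb₁'
  have hle : ∀ b ∈ posRoots ρ, b ∈ U → f b < 0 → f b + τ * offHeight s b ≤ 0 := by
    intro b hb hbU hfb
    have := hmin b ⟨hb, hbU, hfb⟩
    rw [le_div_iff₀ (hoff b hb hfb)] at this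
    linarith
  obtain ⟨b₀, hb₀, hmax⟩ := Set.exists_max_image
    {b | (b ∈ posRoots ρ ∧ b ∈ U ∧ f b < 0) ∧ f b + τ * offHeight s b = 0}
    (fun b => b s / -f b) (hfin.subset fun b hb => hb.1) ⟨b₁, hb₁, by
      rw [hτ, div_mul_cancel₀ _ hb₁'.ne', add_neg_cancel]⟩
  obtain ⟨⟨hb₀p, hb₀U, hfb₀⟩, hb₀τ⟩ := hb₀
  have hb₀' := hoff b₀ hb₀p hfb₀
  have key : ∀ x z : ℝ, x • simpleRoot s + z • -b₀ ∈ rootSet ρ → 0 < z → 0 ≤ x := by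
    intro x z hr hz
    have hr' := h.neg_mem_rootSet hr
    rw [show -(x • simpleRoot s + z • -b₀) = (-x) • simpleRoot s + z • b₀ by module] at hr'
    have e1 : offHeight s ((-x) • simpleRoot s + z • b₀) = z * offHeight s b₀ := by
      simp [offHeight_simpleRoot]
    have e2 : f ((-x) • simpleRoot s + z • b₀) = z * f b₀ := by
      simp [hfs]
    have e3 := hmax ((-x) • simpleRoot s + z • b₀) ⟨⟨h.mem_posRoots_of_offHeight_pos hr' (by
      rw [e1]; positivity), U.add_mem (U.smul_mem _ hsU) (U.smul_mem _ hb₀U), by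
      rw [e2]; exact mul_neg_of_pos_of_neg hz hfb₀⟩, by
      rw [e1, e2]; linear_combination z * hb₀τ⟩
    have e4 : 0 < -f b₀ := neg_pos.2 hfb₀
    simp only [e2, Pi.add_apply, Pi.smul_apply, smul_eq_mul, simpleRoot_self] at e3
    rw [div_le_div_iff₀ (by nlinarith) e4] at e3
    by_contra! hx
    nlinarith
  refine ⟨-b₀, h.neg_mem_rootSet hb₀p.2, U.neg_mem hb₀U, ?_, ?_, by rwa [neg_neg], ?_, τ, hτ0, ?_,
    hle⟩
  · rw [map_neg]
    linarith
  · rw [map_neg]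
    linarith
  · intro x z hr
    rcases lt_trichotomy z 0 with hz | rfl | hz
    · have := key (-x) (-z) (by
        rw [show (-x) • simpleRoot s + (-z) • -b₀ = -(x • simpleRoot s + z • -b₀) by module]
        exact h.neg_mem_rootSet hr) (by linarith)
      nlinarith
    · simp
    · exact mul_nonneg (key x z hr hz) hz.le
  · rw [map_neg, map_neg]
    linarith

end IsGeomRep

lemma eq_zero_of_quadratic_nonpos {C P x y z : ℝ} (hCP : C ^ 2 + P ^ 2 < 1)
    (hq : x ^ 2 + y ^ 2 + z ^ 2 - 2 * C * x * y - 2 * P * x * z ≤ 0) : x = 0 ∧ y = 0 ∧ z = 0 := by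
  have h1 : (x - C * y - P * z) ^ 2 + (C * z - P * y) ^ 2 +
      (1 - C ^ 2 - P ^ 2) * (y ^ 2 + z ^ 2) ≤ 0 := by
    linarith
  have h2 : y ^ 2 + z ^ 2 ≤ 0 := by
    by_contra! h3
    nlinarith [sq_nonneg (x - C * y - P * z), sq_nonneg (C * z - P * y),
      mul_pos (show 0 < 1 - C ^ 2 - P ^ 2 by linarith) h3]
  have hy : y = 0 := by nlinarith [sq_nonneg y, sq_nonneg z]
  have hz : z = 0 := by nlinarith [sq_nonneg y, sq_nonneg z]
  subst hy hz
  exact ⟨by nlinarith, rfl, rfl⟩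

namespace IsGeomRep

lemma bform_lt_one_of_isTitsPoint (h : IsGeomRep cs ρ) {f : (S → ℝ) →ₗ[ℝ] ℝ}
    (hf : IsTitsPoint ρ f) {e b : S → ℝ} (he : IsSmallRoot ρ e) (hfe : f e = 0)
    (hb : b ∈ posRoots ρ) (hfb : f b < 0) : bform M e b < 1 := by
  by_contra! hB
  have hne : b ≠ e := by
    rintro rfl
    linarith
  rcases le_total (height b) (height e) with hle | hle
  · exact hne ((h.isSmallRoot_iff.1 he).2 b hb (by rwa [bform_comm]) hle)
  · have := hf.lt_of_dominates e he.1.2 b hb.2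
      (h.dominates_of_one_le_bform he.1 hb hB hle) hne.symm
    linarith

set_option maxHeartbeats 1000000 in
/-- If `β` forms a canonical pair with a simple root and their reflections generate a finite
dihedral group of order greater than `6`, then `β` is small as soon as its image under the simple
reflection following the reflection in `β` is small. -/
lemma false_of_dominates_of_isSmallRoot (h : IsGeomRep cs ρ) {s : S} {β δ : S → ℝ} {C : ℝ}
    (hβ : β ∈ posRoots ρ) (hcan : IsCanonicalPair ρ (simpleRoot s) β)
    (hC : bform M (simpleRoot s) β = -C) (hC0 : 0 < C) (hC1 : C < 1) (hC2 : 1 / 2 ≤ C ^ 2)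
    (hε : IsSmallRoot ρ (simpleRoot s + (2 * C) • β)) (hδ : δ ∈ posRoots ρ)
    (hdom : Dominates ρ δ β) (hne : δ ≠ β) : False := by
  obtain ⟨f, hf, hfs, hfβ⟩ := h.exists_isTitsPoint (s := s) hβ.2 (by
    rw [hC, abs_neg, abs_of_pos hC0]
    exact hC1)
  have hA := simpleRoot_mem_rootSet ρ s
  have hAA := h.bform_self hA
  have hββ := h.bform_self hβ.2
  have hβA := (bform_comm (M := M) β (simpleRoot s)).trans hC
  have hfδ : f δ < 0 := hfβ ▸ hf.lt_of_dominates δ hδ.2 β hβ.2 hdom hne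
  have hfε : f (simpleRoot s + (2 * C) • β) = 0 := by simp [hfs, hfβ]
  have hC3 := (h.half_le_of_isCanonicalPair hA hβ.2 hcan hC hC0).1
  set U : Submodule ℝ (S → ℝ) := Submodule.span ℝ {simpleRoot s, β, δ} with hU
  have hAU : simpleRoot s ∈ U := Submodule.subset_span (by simp)
  have hβU : β ∈ U := Submodule.subset_span (by simp)
  have hδU : δ ∈ U := Submodule.subset_span (by simp)
  obtain ⟨c, hc, hcU, hfc, hec, hcn, hAc, τ, hτ, hφc, hφ⟩ :=
    h.exists_extremal (s := s) (U := U) (hf.finite.subset fun b hb => ⟨hb.1, hb.2.2.le⟩)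
      ⟨δ, hδ, hδU, hfδ⟩ hfs hAU
  have hcc := h.bform_self hc
  have hεκ : ∀ κ ∈ rootSet ρ, 0 < f κ → offHeight s κ < 0 →
      -1 < bform M (simpleRoot s + (2 * C) • β) κ := by
    intro κ hκ hfκ heκ
    have := h.bform_lt_one_of_isTitsPoint hf hε hfε (h.neg_mem_posRoots_of_offHeight_neg hκ heκ)
      (by rw [map_neg]; linarith)
    rw [bform_neg_right] at this
    linarith
  have heβ : 0 < offHeight s β := h.offHeight_pos hβ fun hh => by
    rw [hh, hAA] at hC
    linarith
  have key : ∀ x z : ℝ, x • β + z • c ∈ rootSet ρ → 0 < z → 0 ≤ x := by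
    intro x z hr hz
    by_contra! hx
    have e1 : f (x • β + z • c) = z * f c := by simp [hfβ]
    have e2 : offHeight s (x • β + z • c) = x * offHeight s β + z * offHeight s c := by simp
    have e3 := hφ _ (h.neg_mem_posRoots_of_offHeight_neg hr (by rw [e2]; nlinarith))
      (U.neg_mem (U.add_mem (U.smul_mem _ hβU) (U.smul_mem _ hcU)))
      (by rw [map_neg, e1]; nlinarith)
    rw [map_neg, map_neg, e1, e2] at e3
    nlinarith [mul_pos hτ heβ]
  have hβc : IsCanonicalPair ρ β c := by
    intro x z hr
    rcases lt_trichotomy z 0 with hz | rfl | hz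
    · have := key (-x) (-z) (by
        rw [show (-x) • β + (-z) • c = -(x • β + z • c) by module]
        exact h.neg_mem_rootSet hr) (by linarith)
      nlinarith
    · simp
    · exact mul_nonneg (key x z hr hz) hz.le
  obtain ⟨P, hP⟩ : ∃ P, bform M (simpleRoot s) c = -P := ⟨_, (neg_neg _).symm⟩
  obtain ⟨g, hg⟩ : ∃ g, bform M β c = -g := ⟨_, (neg_neg _).symm⟩
  have hcA := (bform_comm (M := M) c (simpleRoot s)).trans hP
  have hcβ := (bform_comm (M := M) c β).trans hg
  have hP0 : 0 ≤ P := by linarith [h.bform_nonpos_of_isCanonicalPair hA hc hAc]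
  have hg0 : 0 ≤ g := by linarith [h.bform_nonpos_of_isCanonicalPair hβ.2 hc hβc]
  obtain ⟨x, y, z, hxyz⟩ : ∃ x y z : ℝ, -δ = x • simpleRoot s + y • β + z • c := by
    obtain ⟨p, q, r, hpqr⟩ := Submodule.mem_span_triple.1 hcU
    have hr : r ≠ 0 := by
      rintro rfl
      rw [← hpqr] at hfc
      simp [hfs, hfβ] at hfc
    refine ⟨p / r, q / r, -(1 / r), ?_⟩
    rw [← hpqr]
    ext t
    simp only [Pi.neg_apply, Pi.add_apply, Pi.smul_apply, smul_eq_mul]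
    field_simp
    ring
  have hδβ := h.one_le_bform_of_dominates hδ hβ hdom
  have hq : x ^ 2 + (1 + y) ^ 2 + z ^ 2 - 2 * C * x * (1 + y) - 2 * P * x * z
      - 2 * g * (1 + y) * z ≤ 0 := by
    have e1 : bform M (β - δ) (β - δ) ≤ 0 := by
      simp only [bform_sub_left, bform_sub_right, hββ, h.bform_self hδ.2, bform_comm β δ]
      linarith
    rw [show β - δ = x • simpleRoot s + (1 + y) • β + z • c by
      rw [sub_eq_add_neg, hxyz]; module] at e1
    simp only [bform_add_left, bform_add_right, bform_smul_left, bform_smul_right, hAA, hββ, hcc,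
      hC, hβA, hP, hcA, hg, hcβ] at e1
    linarith
  have hβδ : ¬ (x = 0 ∧ 1 + y = 0 ∧ z = 0) := by
    rintro ⟨h1, h2, h3⟩
    apply hne
    rw [h1, h3, show y = -1 by linarith] at hxyz
    simpa using hxyz
  rcases hP0.eq_or_lt with rfl | hP1
  · have hCg : 2 * C * g < 1 := by
      have := hεκ c hc hfc hec
      simp only [bform_add_left, bform_smul_left, hP, hg] at this
      linarith
    rcases lt_or_ge (C ^ 2 + g ^ 2) 1 with hlt | hge
    · obtain ⟨h1, h2, h3⟩ := eq_zero_of_quadratic_nonpos (x := 1 + y) (y := x) (z := z) hlt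
        (by linarith)
      exact hβδ ⟨h2, h1, h3⟩
    · have hg1 : 0 < g := by
        rcases hg0.eq_or_lt with rfl | hg1
        · nlinarith
        · exact hg1
      have hr1 : β + (2 * g) • c ∈ rootSet ρ := by
        have := h.sub_smul_mem_rootSet hc hβ.2
        rwa [hcβ, show β - (2 * -g) • c = β + (2 * g) • c by module] at this
      have hfr1 : 0 < f (β + (2 * g) • c) := by
        simp only [map_add, map_smul, smul_eq_mul, hfβ]
        positivity
      rcases lt_trichotomy (offHeight s (β + (2 * g) • c)) 0 with hlt | heq | hgt
      · have hr2 : (4 * C ^ 2 - 1) • simpleRoot s + (2 * C) • (β + (2 * g) • c) ∈ rootSet ρ := by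
          have := h.sub_smul_mem_rootSet hc (h.sub_smul_mem_rootSet hA hε.1.2)
          simp only [bform_add_right, bform_sub_right, bform_smul_right, hAA, hC, hcA, hcβ] at this
          convert this using 1
          module
        have := hεκ _ hr2 (by
          simp only [map_add, map_smul, smul_eq_mul, hfs, hfβ]
          simp only [mul_zero, zero_add]
          positivity) (by
          rw [map_add, map_smul, map_smul, offHeight_simpleRoot, smul_eq_mul, smul_eq_mul]
          nlinarith)
        simp only [bform_add_left, bform_add_right, bform_smul_left, bform_smul_right, hAA, hββ,
          hC, hβA, hP, hg] at this
        nlinarith [mul_nonneg (sq_nonneg C) (sub_nonneg.2 hge)]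
      · rcases h.eq_of_offHeight_eq_zero hr1 heq with e | e <;> rw [e] at hfr1 <;>
          simp [hfs] at hfr1
      · have heδ := h.offHeight_pos (s := s) hδ (by rintro rfl; linarith)
        have ef : -f δ = z * f c := by
          rw [← map_neg, hxyz]
          simp [hfs, hfβ]
        have ee : -offHeight s δ = y * offHeight s β + z * offHeight s c := by
          rw [← map_neg, hxyz]
          simp [offHeight_simpleRoot]
        have hz : 0 < z := by
          by_contra! hz
          linarith [mul_nonpos_of_nonpos_of_nonneg hz hfc.le]
        have hy : 0 ≤ y := by
          have e1 := hφ δ hδ hδU hfδ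
          by_contra! hy
          linarith [mul_neg_of_neg_of_pos hy (mul_pos hτ heβ),
            show f δ + τ * offHeight s δ = -(y * (τ * offHeight s β)) by
              linear_combination -ef - τ * ee - z * hφc]
        simp only [map_add, map_smul, smul_eq_mul] at hgt
        have hzg : 2 * g * y < z := by
          by_contra! hle
          linarith [mul_nonneg hy hgt.le,
            mul_nonpos_of_nonneg_of_nonpos (sub_nonneg.2 hle) hec.le]
        have hr3 : x • simpleRoot s + y • β + (2 * g * y - z) • c ∈ rootSet ρ := by
          have := h.sub_smul_mem_rootSet hc (h.neg_mem_rootSet hδ.2)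
          rw [hxyz] at this
          simp only [bform_add_right, bform_smul_right, hcA, hcβ, hcc] at this
          convert this using 1
          module
        have ef3 : f (x • simpleRoot s + y • β + (2 * g * y - z) • c) = (2 * g * y - z) * f c := by
          simp [hfs, hfβ]
        have ee3 : offHeight s (x • simpleRoot s + y • β + (2 * g * y - z) • c) =
            y * offHeight s β + (2 * g * y - z) * offHeight s c := by
          simp [offHeight_simpleRoot]
        have hφ3 := hφ _ (h.mem_posRoots_of_offHeight_pos (s := s) hr3 (by
          rw [ee3]
          linarith [mul_nonneg hy heβ.le, mul_pos_of_neg_of_neg (sub_neg.2 hzg) hec]))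
          (U.add_mem (U.add_mem (U.smul_mem _ hAU) (U.smul_mem _ hβU)) (U.smul_mem _ hcU))
          (by rw [ef3]; exact mul_neg_of_neg_of_pos (sub_neg.2 hzg) hfc)
        have hy0 : y = 0 := by
          rw [ef3, ee3] at hφ3
          refine le_antisymm ?_ hy
          by_contra! hy
          linarith [mul_pos hy (mul_pos hτ heβ),
            show (2 * g * y - z) * f c +
                τ * (y * offHeight s β + (2 * g * y - z) * offHeight s c) =
              y * (τ * offHeight s β) by linear_combination (2 * g * y - z) * hφc]
        subst hy0
        have hr4 : x • simpleRoot s + z • c ∈ rootSet ρ := by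
          have := h.neg_mem_rootSet hδ.2
          rwa [hxyz, zero_smul, add_zero] at this
        have hr5 : (-x) • simpleRoot s + z • c ∈ rootSet ρ := by
          have := h.sub_smul_mem_rootSet hA hr4
          simp only [bform_add_right, bform_smul_right, hAA, hP] at this
          convert this using 1
          module
        have e4 := hAc _ _ hr4
        have e5 := hAc _ _ hr5
        have hx0 : x = 0 := by
          have : x * z = 0 := by linarith
          exact (mul_eq_zero.1 this).resolve_right hz.ne'
        subst hx0
        have hδc : δ = -c := h.eq_of_eq_smul_of_pos hcn hδ (x := z) (by
          rw [← neg_inj, hxyz]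
          module)
        rw [hδc, bform_neg_left, hcβ] at hδβ
        linarith [mul_nonneg hC0.le (show 0 ≤ g - 1 by linarith)]
  · have hlt : C ^ 2 + P ^ 2 + 2 * C * P * g < 1 := by
      have hr : simpleRoot s + (2 * P) • c ∈ rootSet ρ := by
        have := h.sub_smul_mem_rootSet hc hA
        rwa [hcA, show simpleRoot s - (2 * -P) • c = simpleRoot s + (2 * P) • c by module] at this
      have := hεκ _ hr (by
        simp only [map_add, map_smul, smul_eq_mul, hfs, zero_add]
        positivity) (by
        rw [map_add, map_smul, offHeight_simpleRoot, smul_eq_mul]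
        nlinarith)
      simp only [bform_add_left, bform_add_right, bform_smul_left, bform_smul_right, hAA, hβA,
        hP, hg] at this
      nlinarith
    have hP2 := (h.half_le_of_isCanonicalPair hA hc hAc hP hP1).1
    rcases hg0.eq_or_lt with rfl | hg1
    · obtain ⟨h1, h2, h3⟩ := eq_zero_of_quadratic_nonpos (C := C) (P := P) (x := x)
        (y := 1 + y) (z := z) (by linarith) (by linarith)
      exact hβδ ⟨h1, h2, h3⟩
    · have hg2 := (h.half_le_of_isCanonicalPair hβ.2 hc hβc hg hg1).1
      have e1 : 1 / 4 ≤ C * P := by nlinarith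
      nlinarith

lemma coeff_nonneg_of_isCanonicalPair (h : IsGeomRep cs ρ) {s : S} {β : S → ℝ}
    (hβ : β ∈ posRoots ρ) (hcan : IsCanonicalPair ρ (simpleRoot s) β) {x y : ℝ}
    (hr : x • simpleRoot s + y • β ∈ posRoots ρ) : 0 ≤ x ∧ 0 ≤ y := by
  have h1 := hcan x y hr.2
  have h2 := h.height_pos hr
  have h3 := h.height_pos hβ
  have h4 := h.height_pos (h.simpleRoot_mem_posRoots s)
  simp only [map_add, map_smul, smul_eq_mul] at h2
  constructor
  · by_contra! hx
    have hy : y ≤ 0 := by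
      by_contra! hy
      nlinarith
    nlinarith
  · by_contra! hy
    have hx : x ≤ 0 := by
      by_contra! hx
      nlinarith
    nlinarith

/-- If the span of a simple root and a root `β` forming a canonical pair with it contains a small
root other than the given simple root, then `β` is small. -/
lemma isSmallRoot_of_isCanonicalPair (h : IsGeomRep cs ρ) {s : S} {β : S → ℝ}
    (hβ : β ∈ posRoots ρ) (hcan : IsCanonicalPair ρ (simpleRoot s) β)
    (hneg : bform M (simpleRoot s) β < 0) {x y : ℝ}
    (hε : IsSmallRoot ρ (x • simpleRoot s + y • β))
    (hne : x • simpleRoot s + y • β ≠ simpleRoot s) :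
    IsSmallRoot ρ β := by
  obtain ⟨C, hC⟩ : ∃ C, bform M (simpleRoot s) β = -C := ⟨_, (neg_neg _).symm⟩
  have hC0 : 0 < C := by linarith
  have hApos := h.simpleRoot_mem_posRoots s
  have hA := hApos.2
  have hAA := h.bform_self hA
  have hββ := h.bform_self hβ.2
  have hβA := (bform_comm (M := M) β (simpleRoot s)).trans hC
  have htA := h.height_pos hApos
  have htβ := h.height_pos hβ
  have heβ : 0 < offHeight s β := h.offHeight_pos hβ fun hh => by
    rw [hh, hAA] at hC
    linarith
  have hBA : ∀ x y : ℝ, bform M (simpleRoot s) (x • simpleRoot s + y • β) = x - C * y := by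
    intro x y
    rw [bform_add_right, bform_smul_right, bform_smul_right, hAA, hC]
    ring
  have hBβ : ∀ x y : ℝ, bform M β (x • simpleRoot s + y • β) = y - C * x := by
    intro x y
    rw [bform_add_right, bform_smul_right, bform_smul_right, hββ, hβA]
    ring
  have hself : ∀ x y : ℝ, x • simpleRoot s + y • β ∈ rootSet ρ →
      x * (x - C * y) + y * (y - C * x) = 1 := by
    intro x y hr
    have := h.bform_self hr
    rwa [bform_add_left, bform_smul_left, bform_smul_left, hBA, hBβ] at this
  have hht : ∀ x y : ℝ, height (x • simpleRoot s + y • β) =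
      x * height (simpleRoot s) + y * height β := by simp
  have hne' : ∀ x y : ℝ, 0 < y → x • simpleRoot s + y • β ≠ simpleRoot s := by
    intro x y hy hh
    have := congrArg (offHeight s) hh
    simp only [map_add, map_smul, smul_eq_mul, offHeight_simpleRoot] at this
    nlinarith
  have hzero : ∀ y : ℝ, IsSmallRoot ρ ((0 : ℝ) • simpleRoot s + y • β) → IsSmallRoot ρ β := by
    intro y hy
    rwa [← h.eq_of_eq_smul_of_pos hβ hy.1 (x := y) (by module)]
  obtain ⟨hx, hy⟩ := h.coeff_nonneg_of_isCanonicalPair hβ hcan hε.1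
  rcases hy.eq_or_lt with rfl | hy
  · exact absurd (h.eq_of_eq_smul_of_pos hApos hε.1 (x := x) (by module)) hne
  rcases hx.eq_or_lt with rfl | hx
  · exact hzero y hε
  rcases le_or_gt 1 C with hC1 | hC1
  · have h1 := hself x y hε.1.2
    have h2 := h.bform_simpleRoot_lt_one hε hne
    rw [hBA] at h2
    have hCC : 1 ≤ C ^ 2 := one_le_pow₀ hC1
    have h3 : x - C * y ≤ 0 := by
      by_contra! h3
      have : 1 ≤ (x - C * y) ^ 2 := by nlinarith [mul_nonneg (sub_nonneg.2 hCC) (sq_nonneg y)]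
      nlinarith
    have h4 : 0 < y - C * x := by
      by_contra! h4
      nlinarith
    have h5 : 1 ≤ y - C * x := by
      have : 1 ≤ (y - C * x) ^ 2 := by nlinarith [mul_nonneg (sub_nonneg.2 hCC) (sq_nonneg x)]
      nlinarith
    have h6 : 1 ≤ y := by nlinarith
    rw [(h.isSmallRoot_iff.1 hε).2 β hβ (by rwa [hBβ]) (by rw [hht]; nlinarith)]
    exact hε
  by_contra hns
  obtain ⟨b, ⟨hb, x, y, hx, hy, rfl⟩, hmin⟩ := Set.exists_min_image
    {b | IsSmallRoot ρ b ∧ ∃ x y : ℝ, 0 < x ∧ 0 < y ∧ b = x • simpleRoot s + y • β} height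
    (h.finite_isSmallRoot.subset fun b hb => hb.1) ⟨_, hε, x, y, hx, hy, rfl⟩
  have h1 := hself x y hb.1.2
  rcases lt_or_ge 0 (x - C * y) with hp | hp
  · have h2 := h.isSmallRoot_simple_apply hb (hne' x y hy) (by rwa [hBA])
    rw [h.simple_apply, hBA, show x • simpleRoot s + y • β - (2 * (x - C * y)) • simpleRoot s =
      (x - 2 * (x - C * y)) • simpleRoot s + y • β by module] at h2
    rcases (h.coeff_nonneg_of_isCanonicalPair hβ hcan h2.1).1.eq_or_lt with h3 | h3
    · rw [← h3] at h2
      exact hns (hzero y h2)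
    · have := hmin _ ⟨h2, _, y, h3, hy, rfl⟩
      rw [hht, hht] at this
      nlinarith
  · have hq : 0 < y - C * x := by
      by_contra! hq
      nlinarith
    have hr := h.sub_smul_mem_rootSet hβ.2 hb.1.2
    rw [hBβ, show x • simpleRoot s + y • β - (2 * (y - C * x)) • β =
      x • simpleRoot s + (y - 2 * (y - C * x)) • β by module] at hr
    have h2 : 0 ≤ y - 2 * (y - C * x) := nonneg_of_mul_nonneg_right (hcan _ _ hr) hx
    have hrp : x • simpleRoot s + (y - 2 * (y - C * x)) • β ∈ posRoots ρ := by
      refine h.mem_posRoots_iff.2 ⟨hr, ?_⟩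
      rw [hht]
      positivity
    have hrs : IsSmallRoot ρ (x • simpleRoot s + (y - 2 * (y - C * x)) • β) := by
      by_contra hrs
      have h3 := (h.not_isSmallRoot_sub_smul hrp hrs hβ (by rw [hBβ]; linarith)).2
      rw [hBβ] at h3
      apply h3
      convert hb using 1
      module
    rcases h2.eq_or_lt with h3 | h3
    · have h4 : x • simpleRoot s + (y - 2 * (y - C * x)) • β = simpleRoot s :=
        h.eq_of_eq_smul_of_pos hApos hrp (x := x) (by rw [← h3]; module)
      rw [← h3, zero_smul, add_zero] at h4
      have hx1 : x = 1 := by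
        have := congrFun h4 s
        rwa [Pi.smul_apply, simpleRoot_self, smul_eq_mul, mul_one] at this
      subst hx1
      have hy1 : y = 2 * C := by linarith
      subst hy1
      rcases (h.half_le_of_isCanonicalPair hA hβ.2 hcan hC hC0).2 with h5 | h5
      · rw [h5] at hp
        norm_num at hp
      · obtain ⟨δ, hδ, hdom, hδβ⟩ := h.exists_dominates_of_not_isSmallRoot hβ hns
        rw [one_smul] at hb
        exact h.false_of_dominates_of_isSmallRoot hβ hcan hC hC0 hC1 h5 hb hδ hdom hδβ
    · have := hmin _ ⟨hrs, x, _, hx, h3, rfl⟩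
      rw [hht, hht] at this
      nlinarith

lemma isLow_of_isLow_simple_mul (h : IsGeomRep cs ρ) {s : S} {u : W}
    (hw : IsLow cs ρ (cs.simple s * u)) (hl : cs.length (cs.simple s * u) = cs.length u + 1) :
    IsLow cs ρ u := by
  intro β hβ
  have hβN := h.nOne_subset_invSet u hβ
  have hβp := hβN.1
  obtain ⟨-, hβl⟩ := h.mem_nOne_iff_length.1 hβ
  have hApos := h.simpleRoot_mem_posRoots s
  have hsN : simpleRoot s ∉ invSet ρ u := by
    rw [h.mem_invSet_simple_iff]
    omega
  have hβs : β ≠ simpleRoot s := by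
    rintro rfl
    exact hsN hβN
  have hsβ := h.simple_apply_mem_posRoots hβp hβs
  by_cases h1 : ρ (cs.simple s) β ∈ nOne cs ρ (cs.simple s * u)
  · by_contra hns
    obtain ⟨δ, hδ, hdom, hne⟩ := h.exists_dominates_of_not_isSmallRoot hβp hns
    have hδN : δ ∈ invSet ρ u := ⟨hδ, hdom _ hβN.2⟩
    have hδs : δ ≠ simpleRoot s := by
      rintro rfl
      exact hsN hδN
    exact hne ((ρ (cs.simple s)).injective
      ((hw _ h1).2 _ (h.simple_apply_mem_posRoots hδ hδs) (h.dominates_apply hdom _)))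
  have hl2 : cs.length (cs.simple s * (reflOf M ρ β * u)) + 1 = cs.length (reflOf M ρ β * u) := by
    rw [h.mem_nOne_iff_length, and_iff_right hsβ, h.reflOf_conj hβp.2, cs.inv_simple, mul_assoc,
      mul_assoc, cs.simple_mul_simple_cancel_left] at h1
    have := cs.length_simple_mul (reflOf M ρ β * u) s
    omega
  have hsN2 : simpleRoot s ∈ invSet ρ (reflOf M ρ β * u) := by
    rw [h.mem_invSet_simple_iff]
    omega
  have hA1 : 0 < height (ρ u⁻¹ (simpleRoot s)) :=
    h.height_pos_of_not_neg (apply_mem_rootSet hApos.2 _)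
      fun hh => hsN (h.mem_invSet_iff.2 ⟨hApos, hh⟩)
  have hβ1 := (h.mem_invSet_iff.1 hβN).2
  have hζ := (h.mem_invSet_iff.1 hsN2).2
  rw [mul_inv_rev, h.inv_reflOf hβp.2, rho_mul_apply, h.reflOf_apply hβp.2] at hζ
  have hB : bform M β (simpleRoot s) < 0 := by
    by_contra! hB
    rw [map_sub, map_smul, map_sub, map_smul, smul_eq_mul] at hζ
    nlinarith
  obtain ⟨C, hC⟩ : ∃ C, bform M β (simpleRoot s) = -C := ⟨_, (neg_neg _).symm⟩
  have hC0 : 0 < C := by linarith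
  have hζN : simpleRoot s + (2 * C) • β ∈ invSet ρ u := by
    have hr := h.sub_smul_mem_rootSet hβp.2 hApos.2
    rw [hC, show simpleRoot s - (2 * -C) • β = simpleRoot s + (2 * C) • β by module] at hr hζ
    refine h.mem_invSet_iff.2 ⟨h.mem_posRoots_iff.2 ⟨hr, ?_⟩, hζ⟩
    have := h.height_pos hApos
    have := h.height_pos hβp
    rw [map_add, map_smul, smul_eq_mul]
    positivity
  have heβ := h.offHeight_pos hβp hβs
  have hindep : ∀ x y : ℝ, x • simpleRoot s + y • β = β → x = 0 := by
    intro x y hxy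
    have h2 := congrArg (offHeight s) hxy
    rw [map_add, map_smul, map_smul, offHeight_simpleRoot, smul_eq_mul, smul_eq_mul, mul_zero,
      zero_add, mul_eq_right₀ heβ.ne'] at h2
    rw [h2, one_smul, add_eq_right] at hxy
    have h3 := congrFun hxy s
    rwa [Pi.smul_apply, simpleRoot_self, smul_eq_mul, mul_one] at h3
  have key : ∀ x y : ℝ, x • simpleRoot s + y • β ∈ rootSet ρ → x < 0 → 0 < y → False := by
    intro x y hr hx hy
    have hδ : x • simpleRoot s + y • β ∈ invSet ρ u := by
      refine h.mem_invSet_iff.2 ⟨h.mem_posRoots_of_offHeight_pos (s := s) hr ?_, ?_⟩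
      · rw [map_add, map_smul, map_smul, offHeight_simpleRoot, smul_eq_mul, smul_eq_mul, mul_zero,
          zero_add]
        positivity
      · rw [map_add, map_smul, map_smul, map_add, map_smul, map_smul, smul_eq_mul, smul_eq_mul]
        nlinarith
    obtain ⟨d, hd⟩ : ∃ d, d = y + 2 * C * -x := ⟨_, rfl⟩
    have hd0 : 0 < d := by nlinarith
    refine h.ne_smul_add_smul_of_mem_nOne hβ hδ hζN (fun hh => hx.ne (hindep _ _ hh))
      (fun hh => one_ne_zero (hindep 1 (2 * C) (by rwa [one_smul])))
      (a := 1 / d) (b := -x / d) (by positivity) (div_pos (by linarith) hd0) ?_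
    ext t
    simp only [Pi.add_apply, Pi.smul_apply, smul_eq_mul]
    field_simp
    rw [hd]
    ring
  have hcan : IsCanonicalPair ρ (simpleRoot s) β := by
    intro x y hr
    by_contra! hxy
    rcases mul_neg_iff.1 hxy with ⟨hx, hy⟩ | ⟨hx, hy⟩
    · refine key (-x) (-y) ?_ (by linarith) (by linarith)
      rw [show (-x) • simpleRoot s + (-y) • β = -(x • simpleRoot s + y • β) by module]
      exact h.neg_mem_rootSet hr
    · exact key x y hr hx hy
  obtain ⟨c, hc, -, -, hcU, -, -, hcs, hcl⟩ := h.exists_other_reflOf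
    (Submodule.span ℝ {simpleRoot s, β}) (w := cs.simple s * u) hApos.2 hβp.2
    (Submodule.subset_span (by simp)) (Submodule.subset_span (by simp))
    (by rw [h.reflOf_simpleRoot, cs.simple_mul_simple_cancel_left, hl])
    (by rwa [h.reflOf_simpleRoot, cs.simple_mul_simple_cancel_left])
  wlog hcp : c ∈ posRoots ρ generalizing c
  · refine this (-c) (h.neg_mem_rootSet hc) (Submodule.neg_mem _ hcU) ?_ ?_
      (h.neg_mem_posRoots hc hcp) <;> rwa [h.reflOf_neg hc]
  obtain ⟨x, y, rfl⟩ := Submodule.mem_span_pair.1 hcU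
  refine h.isSmallRoot_of_isCanonicalPair hβp hcan (by rwa [bform_comm])
    (hw _ (h.mem_nOne_iff_length.2 ⟨hcp, hcl⟩)) fun hh => hcs ?_
  rw [hh]

lemma isLow_of_isSuffixOf (h : IsGeomRep cs ρ) {w u : W} (hw : IsLow cs ρ w)
    (hs : IsSuffixOf cs u w) : IsLow cs ρ u := by
  obtain ⟨v, rfl, hl⟩ := hs
  obtain ⟨n, hn⟩ : ∃ n, cs.length v = n := ⟨_, rfl⟩
  induction n generalizing v with
  | zero =>
    rw [cs.length_eq_zero_iff] at hn
    rwa [hn, one_mul] at hw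
  | succ n ih =>
    obtain ⟨s, hs⟩ := cs.exists_leftDescent_of_ne_one (w := v) (by
      rintro rfl
      simp at hn)
    rw [cs.isLeftDescent_iff] at hs
    have e : v * u = cs.simple s * (cs.simple s * v * u) := by
      rw [mul_assoc, cs.simple_mul_simple_cancel_left]
    have h1 := cs.length_mul_le (cs.simple s * v) u
    have h2 := cs.length_simple_mul (cs.simple s * v * u) s
    rw [← e] at h2
    rw [e] at hw
    refine ih _ (h.isLow_of_isLow_simple_mul hw ?_) ?_ ?_
    · rw [← e]
      omega
    · omega
    · omega

end IsGeomRep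

end LowElements

/-- **Theorem 1.2.** For every Coxeter system `(W, S)` with `S` finite, the set `L` of all
low elements of `W` includes `S`, is finite, is closed under join with respect to the
right weak order, and is closed under suffix. -/
theorem lowElements_finite_closed_join_suffix {S : Type*} [Fintype S] [DecidableEq S]
    (Mmat : CoxeterMatrix S) {W : Type*} [Group W] (cs : CoxeterSystem Mmat W)
    (ρ : W →* ((S → ℝ) ≃ₗ[ℝ] (S → ℝ)))
    (hfaith : Function.Injective ρ)
    (hρ : ∀ (s : S) (v : S → ℝ),
      ρ (cs.simple s) v = v - (2 * bform Mmat (simpleRoot s) v) • simpleRoot s) :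
    (∀ s : S, IsLow cs ρ (cs.simple s)) ∧
    {w : W | IsLow cs ρ w}.Finite ∧
    (∀ u v j : W, IsLow cs ρ u → IsLow cs ρ v → IsJoin cs u v j → IsLow cs ρ j) ∧
    (∀ w u : W, IsLow cs ρ w → IsSuffixOf cs u w → IsLow cs ρ u) := by
  have h : IsGeomRep cs ρ := ⟨hfaith, hρ⟩
  exact ⟨h.isLow_simple, h.finite_isLow, fun _ _ _ hu hv hj => h.isLow_of_isJoin hu hv hj,
    fun _ _ hw hs => h.isLow_of_isSuffixOf hw hs⟩
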